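/- Reparametrization invariance of the VV-integral over foliated singular manifolds: Let Ω, Ω' ⊆ ℝ^m be domains, let φ_0 : Ω' → Ω be a C^∞ diffeomorphism with det(∂φ_0/∂q') > 0 on Ω', and let φ_1(q',ϑ') = (φ_{1,1},…,φ_{1,n}) with each φ_{1,k} an odd expression Σ_{c∈{0,1}^n} ϑ'^c g_{k,c}(q') with coefficients g_{k,c} ∈ C^∞(Ω', Λ) of parity (|c|+1) mod 2, such that the n×n matrix ∂φ_1/∂ϑ' is invertible over the even part at every point; set φ(q',ϑ') := (φ_0(q'), φ_1(q',ϑ')). Then for every path γ from Ω̃ = Ω × (ϑ₁,…,ϑₙ) into (m|n)-superspace with sdet J(γ) invertible and every supersmooth u integrable on 𝔐 = γ(Ω̃), the composite γ∘φ is a path from Ω̃' = Ω' × (ϑ'₁,…,ϑ'ₙ) and VV∬_{γ(Ω̃)} dxdθ u(x,θ) = VV∬_{(γ∘φ)(Ω̃')} dx'dθ' u(x',θ'); i.e. ∫_Ω dq [coefficient of ϑ₁⋯ϑₙ in sdet J(γ)(q,ϑ)·u(γ(q,ϑ))] = ∫_{Ω'} dq' [coefficient of ϑ'₁⋯ϑ'ₙ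 in sdet J(γ∘φ)(q',ϑ')·u(γ∘φ(q',ϑ'))]. -/

import Mathlib

set_option synthInstance.maxHeartbeats 1000000
set_option maxHeartbeats 4000000

noncomputable section

open MeasureTheory

/-- Index type for the Grassmann generators: `L` generators `σ` (generating `Λ`) and three
banks of `n` odd generators (`θ₁,…,θₙ`, `ω₁,…,ωₙ`, `ϑ₁,…,ϑₙ`). -/
abbrev GIdx (L n : ℕ) : Type := Fin L ⊕ (Fin n ⊕ (Fin n ⊕ Fin n))

/- `E` is the (finite-dimensional) complex Grassmann algebra on the generators indexed by
`GIdx L n`, realized as a normed algebra identified with the exterior algebra via an algebra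
isomorphism `g`. -/
variable {L m n : ℕ} {E : Type} [NormedRing E] [NormedAlgebra ℂ E] [CompleteSpace E]

/-- A generator of `E` attached to a vector. -/
def gen (g : ExteriorAlgebra ℂ (GIdx L n → ℂ) ≃ₐ[ℂ] E) (v : GIdx L n → ℂ) : E :=
  g (ExteriorAlgebra.ι ℂ v)

/-- The generators `σ_i` of `Λ`. -/
def σg (g : ExteriorAlgebra ℂ (GIdx L n → ℂ) ≃ₐ[ℂ] E) (i : Fin L) : E :=
  gen g (Pi.single (Sum.inl i) 1)

/-- The odd generators `θ_k`. -/
def θg (g : ExteriorAlgebra ℂ (GIdx L n → ℂ) ≃ₐ[ℂ] E) (k : Fin n) : E :=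
  gen g (Pi.single (Sum.inr (Sum.inl k)) 1)

/-- The odd generators `ω_k`. -/
def ωg (g : ExteriorAlgebra ℂ (GIdx L n → ℂ) ≃ₐ[ℂ] E) (k : Fin n) : E :=
  gen g (Pi.single (Sum.inr (Sum.inr (Sum.inl k))) 1)

/-- The odd generators `ϑ_k`. -/
def ϑg (g : ExteriorAlgebra ℂ (GIdx L n → ℂ) ≃ₐ[ℂ] E) (k : Fin n) : E :=
  gen g (Pi.single (Sum.inr (Sum.inr (Sum.inr k))) 1)

/-- The even part `E_ev`. -/
def evenPart (g : ExteriorAlgebra ℂ (GIdx L n → ℂ) ≃ₐ[ℂ] E) : Submodule ℂ E :=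
  (CliffordAlgebra.evenOdd (0 : QuadraticForm ℂ (GIdx L n → ℂ)) 0).map g.toLinearMap

/-- The odd part `E_od`. -/
def oddPart (g : ExteriorAlgebra ℂ (GIdx L n → ℂ) ≃ₐ[ℂ] E) : Submodule ℂ E :=
  (CliffordAlgebra.evenOdd (0 : QuadraticForm ℂ (GIdx L n → ℂ)) 1).map g.toLinearMap

/-- The subalgebra `Λ ⊆ E` generated by the `σ`'s. -/
def ΛSub (g : ExteriorAlgebra ℂ (GIdx L n → ℂ) ≃ₐ[ℂ] E) : Subalgebra ℂ E :=
  Algebra.adjoin ℂ (Set.range (σg g))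

/-- The subalgebra of `E` generated by the `σ`'s and the `ϑ`'s. -/
def ΛϑSub (g : ExteriorAlgebra ℂ (GIdx L n → ℂ) ≃ₐ[ℂ] E) : Subalgebra ℂ E :=
  Algebra.adjoin ℂ (Set.range (σg g) ∪ Set.range (ϑg g))

/-- The body map `π_B : E → ℂ`. -/
def πB (g : ExteriorAlgebra ℂ (GIdx L n → ℂ) ≃ₐ[ℂ] E) : E →ₐ[ℂ] ℂ :=
  (ExteriorAlgebra.algebraMapInv).comp g.symm.toAlgHom

/-- The soul `x_S = x − π_B(x)·1` (nilpotent). -/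
def soul (g : ExteriorAlgebra ℂ (GIdx L n → ℂ) ≃ₐ[ℂ] E) (x : E) : E :=
  x - algebraMap ℂ E (πB g x)

/-- Contraction (left odd derivative) with respect to the generator indexed by `idx`. -/
def Dop (g : ExteriorAlgebra ℂ (GIdx L n → ℂ) ≃ₐ[ℂ] E) (idx : GIdx L n) : E →ₗ[ℂ] E :=
  g.toLinearMap ∘ₗ
    (CliffordAlgebra.contractLeft (Q := (0 : QuadraticForm ℂ (GIdx L n → ℂ)))
      (LinearMap.proj idx)) ∘ₗ g.symm.toLinearMap

/-- `∂_{θ_k}`. -/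
def Dθ (g : ExteriorAlgebra ℂ (GIdx L n → ℂ) ≃ₐ[ℂ] E) (k : Fin n) : E →ₗ[ℂ] E :=
  Dop g (Sum.inr (Sum.inl k))

/-- `∂_{ω_k}`. -/
def Dω (g : ExteriorAlgebra ℂ (GIdx L n → ℂ) ≃ₐ[ℂ] E) (k : Fin n) : E →ₗ[ℂ] E :=
  Dop g (Sum.inr (Sum.inr (Sum.inl k)))

/-- `∂_{ϑ_k}`. -/
def Dϑ (g : ExteriorAlgebra ℂ (GIdx L n → ℂ) ≃ₐ[ℂ] E) (k : Fin n) : E →ₗ[ℂ] E :=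
  Dop g (Sum.inr (Sum.inr (Sum.inr k)))

/-- The linear projection on generators keeping only the indices where `keep` is `true`. -/
def keepLin (L n : ℕ) (keep : GIdx L n → Bool) : (GIdx L n → ℂ) →ₗ[ℂ] (GIdx L n → ℂ) where
  toFun v idx := if keep idx then v idx else 0
  map_add' x y := by funext idx; by_cases h : keep idx <;> simp [h]
  map_smul' c x := by funext idx; by_cases h : keep idx <;> simp [h]

/-- The algebra endomorphism of `E` killing the generators where `keep` is `false`. -/
def evalKill (g : ExteriorAlgebra ℂ (GIdx L n → ℂ) ≃ₐ[ℂ] E) (keep : GIdx L n → Bool) :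
    E →ₐ[ℂ] E :=
  (g.toAlgHom.comp (CliffordAlgebra.map ⟨keepLin L n keep, fun _ => rfl⟩)).comp
    g.symm.toAlgHom

/-- indices other than the `θ` bank. -/
def notθ : GIdx L n → Bool := fun idx =>
  match idx with
  | .inr (.inl _) => false
  | _ => true

/-- indices other than the `ω` bank. -/
def notω : GIdx L n → Bool := fun idx =>
  match idx with
  | .inr (.inr (.inl _)) => false
  | _ => true

/-- indices other than the `ϑ` bank. -/
def notϑ : GIdx L n → Bool := fun idx =>
  match idx with
  | .inr (.inr (.inr _)) => false
  | _ => true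

/-- Berezin extraction of the `θ` top coefficient: `∂_{θ_n}⋯∂_{θ_1}(·)|_{θ=0}`. -/
def Bθ (g : ExteriorAlgebra ℂ (GIdx L n → ℂ) ≃ₐ[ℂ] E) (v : E) : E :=
  evalKill g notθ ((List.finRange n).foldl (fun w k => Dθ g k w) v)

/-- Berezin extraction of the `ω` top coefficient. -/
def Bω (g : ExteriorAlgebra ℂ (GIdx L n → ℂ) ≃ₐ[ℂ] E) (v : E) : E :=
  evalKill g notω ((List.finRange n).foldl (fun w k => Dω g k w) v)

/-- Berezin extraction of the `ϑ` top coefficient. -/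
def Bϑ (g : ExteriorAlgebra ℂ (GIdx L n → ℂ) ≃ₐ[ℂ] E) (v : E) : E :=
  evalKill g notϑ ((List.finRange n).foldl (fun w k => Dϑ g k w) v)

/-- `θ^a`, factors in increasing order. -/
def θpow (g : ExteriorAlgebra ℂ (GIdx L n → ℂ) ≃ₐ[ℂ] E) (a : Fin n → Bool) : E :=
  (List.ofFn fun k => if a k then θg g k else 1).prod

/-- `ω^a`, factors in increasing order. -/
def ωpow (g : ExteriorAlgebra ℂ (GIdx L n → ℂ) ≃ₐ[ℂ] E) (a : Fin n → Bool) : E :=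
  (List.ofFn fun k => if a k then ωg g k else 1).prod

/-- `ϑ^a`, factors in increasing order. -/
def ϑpow (g : ExteriorAlgebra ℂ (GIdx L n → ℂ) ≃ₐ[ℂ] E) (a : Fin n → Bool) : E :=
  (List.ofFn fun k => if a k then ϑg g k else 1).prod

/-- `w^a` for a tuple `w` of (odd) elements of `E`, factors in increasing order. -/
def oddprod (w : Fin n → E) (a : Fin n → Bool) : E :=
  (List.ofFn fun k => if a k then w k else 1).prod

/-- `|a|`: number of `1` entries of a multi-index `a ∈ {0,1}ⁿ`. -/
def mIdxCard {n : ℕ} (a : Fin n → Bool) : ℕ := (Finset.univ.filter fun k => a k).card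

/-- Determinant of a square matrix with entries in `E` (intended for even, hence central,
entries), as the signed sum over permutations of ordered products. -/
def detE {k : ℕ} (M : Matrix (Fin k) (Fin k) E) : E :=
  ∑ σ : Equiv.Perm (Fin k), (Equiv.Perm.sign σ : ℤ) • (List.ofFn fun i => M (σ i) i).prod

/-- Partial derivative `∂/∂q_j` of an `E`-valued function on `ℝ^m`. -/
def pd (j : Fin m) (f : (Fin m → ℝ) → E) : (Fin m → ℝ) → E :=
  fun q => fderiv ℝ f q (Pi.single j 1)

/-- Iterated partial derivatives along a list of directions. -/
def pdIter (l : List (Fin m)) (f : (Fin m → ℝ) → E) : (Fin m → ℝ) → E :=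
  l.foldl (fun h j => pd j h) f

/-- The list of directions attached to a multi-index `α ∈ ℕ^m`. -/
def mlist {m : ℕ} (α : Fin m → ℕ) : List (Fin m) :=
  (List.finRange m).flatMap fun j => List.replicate (α j) j

/-- The (real) body vector of a tuple of even elements. -/
def bodyVec (g : ExteriorAlgebra ℂ (GIdx L n → ℂ) ≃ₐ[ℂ] E) (x : Fin m → E) : Fin m → ℝ :=
  fun j => (πB g (x j)).re

/-- Grassmann continuation `f̃(x) = Σ_α (1/α!) (∂^α f)(π_B x)·x_S^α` of `f : ℝ^m → Λ`,
evaluated at a tuple `x` of even elements with real bodies; the sum is finite since souls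
are nilpotent (order `> L + 3n` terms vanish). -/
def gcont (g : ExteriorAlgebra ℂ (GIdx L n → ℂ) ≃ₐ[ℂ] E)
    (f : (Fin m → ℝ) → E) (x : Fin m → E) : E :=
  ∑ α ∈ Fintype.piFinset (fun _ : Fin m => Finset.range (L + 3 * n + 1)),
    (((∏ j, (α j).factorial : ℕ) : ℂ))⁻¹ •
      (pdIter (mlist α) f (bodyVec g x) * (List.ofFn fun j => soul g (x j) ^ α j).prod)

/-- Evaluation of a supersmooth function, given by its coefficient family
`c : {0,1}ⁿ → C^∞(ℝ^m, Λ)`, at a superpoint `(x, w)` (`x` even with real bodies, `w` odd):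
`Σ_a w^a·(c_a)~(x)`. -/
def seval (g : ExteriorAlgebra ℂ (GIdx L n → ℂ) ≃ₐ[ℂ] E)
    (c : (Fin n → Bool) → (Fin m → ℝ) → E) (x : Fin m → E) (w : Fin n → E) : E :=
  ∑ a : Fin n → Bool, oddprod w a * gcont g (c a) x

namespace SuperCalc

omit [CompleteSpace E]

variable (g : ExteriorAlgebra ℂ (GIdx L n → ℂ) ≃ₐ[ℂ] E)

section Parity

/-- The generator of `E` with index `i`. -/
def basisGen (i : GIdx L n) : E := gen g (Pi.single i 1)

/-- The parity automorphism of `E`, negating every generator. -/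
def parity : E →ₐ[ℂ] E :=
  (g.toAlgHom.comp CliffordAlgebra.involute).comp g.symm.toAlgHom

lemma gen_eq_sum (v : GIdx L n → ℂ) : gen g v = ∑ i, v i • basisGen g i := by
  have h : v = ∑ i, v i • (Pi.single i 1 : GIdx L n → ℂ) := by
    ext j; simp [Finset.sum_apply, Pi.single_apply]
  conv_lhs => rw [h]
  simp [gen, basisGen]

lemma gen_induction {P : E → Prop} (one : P 1) (add : ∀ x y, P x → P y → P (x + y))
    (smul : ∀ (c : ℂ) x, P x → P (c • x)) (mul : ∀ i x, P x → P (basisGen g i * x)) (x : E) :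
    P x := by
  have key : ∀ y : ExteriorAlgebra ℂ (GIdx L n → ℂ), P (g y) := by
    intro y
    refine CliffordAlgebra.left_induction _ (P := fun y => P (g y)) ?_ ?_ ?_ y
    · intro r
      rw [AlgEquiv.commutes, Algebra.algebraMap_eq_smul_one]
      exact smul r _ one
    · intro x y hx hy
      rw [map_add]; exact add _ _ hx hy
    · intro x v hx
      rw [map_mul]
      change P (gen g v * g x)
      rw [gen_eq_sum, Finset.sum_mul]
      refine Finset.sum_induction _ P add ?_ ?_
      · simpa using smul 0 _ one
      · intro i _
        rw [smul_mul_assoc]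
        exact smul _ _ (mul i _ hx)
  simpa using key (g.symm x)

lemma algHom_ext' {A : Type*} [Ring A] [Algebra ℂ A] {Φ Ψ : E →ₐ[ℂ] A}
    (h : ∀ i, Φ (basisGen g i) = Ψ (basisGen g i)) : Φ = Ψ := by
  ext x
  induction x using gen_induction g with
  | one => simp
  | add x y hx hy => simp [hx, hy]
  | smul c x hx => simp [hx]
  | mul i x hx => simp [hx, h]

@[simp] lemma parity_basisGen (i : GIdx L n) : parity g (basisGen g i) = -basisGen g i := by
  change g (CliffordAlgebra.involute (g.symm (g (CliffordAlgebra.ι _ _)))) = _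
  rw [AlgEquiv.symm_apply_apply, CliffordAlgebra.involute_ι, map_neg]
  rfl

lemma parity_of_mem_evenPart {x : E} (hx : x ∈ evenPart g) : parity g x = x := by
  obtain ⟨y, hy, rfl⟩ := hx
  change g (CliffordAlgebra.involute (g.symm (g y))) = g y
  rw [AlgEquiv.symm_apply_apply, CliffordAlgebra.involute_eq_of_mem_even hy]

lemma parity_of_mem_oddPart {x : E} (hx : x ∈ oddPart g) : parity g x = -x := by
  obtain ⟨y, hy, rfl⟩ := hx
  change g (CliffordAlgebra.involute (g.symm (g y))) = -g y
  rw [AlgEquiv.symm_apply_apply, CliffordAlgebra.involute_eq_of_mem_odd hy, map_neg]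

lemma basisGen_mul_swap (i j : GIdx L n) :
    basisGen g i * basisGen g j = -(basisGen g j * basisGen g i) := by
  rw [eq_neg_iff_add_eq_zero]
  change g (ExteriorAlgebra.ι ℂ _) * g (ExteriorAlgebra.ι ℂ _)
    + g (ExteriorAlgebra.ι ℂ _) * g (ExteriorAlgebra.ι ℂ _) = 0
  rw [← map_mul g, ← map_mul g, ← map_add, ExteriorAlgebra.ι_add_mul_swap, map_zero]

lemma basisGen_sq (i : GIdx L n) : basisGen g i * basisGen g i = 0 := by
  change g (ExteriorAlgebra.ι ℂ _) * g (ExteriorAlgebra.ι ℂ _) = 0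
  rw [← map_mul, ExteriorAlgebra.ι_sq_zero, map_zero]

lemma mul_basisGen (x : E) (i : GIdx L n) :
    x * basisGen g i = basisGen g i * parity g x := by
  induction x using gen_induction g with
  | one => simp
  | add x y hx hy => simp [add_mul, mul_add, hx, hy]
  | smul c x hx => simp [hx]
  | mul j x hx =>
    rw [mul_assoc, hx, ← mul_assoc, basisGen_mul_swap, map_mul, parity_basisGen]
    simp [mul_assoc]

lemma even_mul_comm {x : E} (hx : parity g x = x) (y : E) : x * y = y * x := by
  induction y using gen_induction g with
  | one => simp
  | add y z hy hz => simp [add_mul, mul_add, hy, hz]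
  | smul c y hy => simp [hy]
  | mul i y hy => rw [← mul_assoc, mul_basisGen, hx, mul_assoc, hy, mul_assoc]

lemma odd_mul {x : E} (hx : parity g x = -x) (y : E) : x * y = parity g y * x := by
  induction y using gen_induction g with
  | one => simp
  | add y z hy hz => simp [add_mul, mul_add, hy, hz]
  | smul c y hy => simp [hy]
  | mul i y hy => rw [← mul_assoc, mul_basisGen, hx, map_mul, parity_basisGen, mul_assoc,
      neg_mul, hy, mul_neg, neg_mul, neg_mul, mul_assoc]

lemma odd_mul_odd {x y : E} (hx : parity g x = -x) (hy : parity g y = -y) :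
    x * y = -(y * x) := by
  rw [odd_mul g hx, hy, neg_mul]

lemma odd_sq {x : E} (hx : parity g x = -x) : x * x = 0 := by
  have h2 : (2 : ℂ) • (x * x) = 0 := by
    rw [two_smul]; nth_rw 1 [odd_mul_odd g hx hx]; exact neg_add_cancel _
  simpa using h2

/-- The entries of an inverse of an even matrix are even. -/
lemma parity_inverse {ι : Type*} [Fintype ι] [DecidableEq ι] {A P : Matrix ι ι E}
    (hA : ∀ i j, parity g (A i j) = A i j) (h₁ : A * P = 1) (h₂ : P * A = 1) (i j : ι) :
    parity g (P i j) = P i j := by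
  have hA' : A.map (parity g) = A := by ext i j; exact hA i j
  have h₃ : A * P.map (parity g) = 1 := by
    have := congrArg (fun M : Matrix ι ι E => M.map (parity g)) h₁
    simpa [Matrix.map_mul, hA'] using this
  have : P.map (parity g) = P := by
    calc P.map (parity g) = P * A * P.map (parity g) := by rw [h₂, one_mul]
      _ = P := by rw [mul_assoc, h₃, mul_one]
  exact congrFun (congrFun this i) j

lemma parity_inverse_elem {x y : E} (hx : parity g x = x) (h : x * y = 1) :
    parity g y = y := by
  have h₂ : y * x = 1 := by rw [← even_mul_comm g hx, h]
  have h₃ : x * parity g y = 1 := by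
    have := congrArg (parity g) h
    simpa [hx] using this
  calc parity g y = y * x * parity g y := by rw [h₂, one_mul]
    _ = y := by rw [mul_assoc, h₃, mul_one]

end Parity

section Derivations

lemma Dop_gen_mul (i : GIdx L n) (v : GIdx L n → ℂ) (x : E) :
    Dop g i (gen g v * x) = v i • x - gen g v * Dop g i x := by
  change g (CliffordAlgebra.contractLeft _ (g.symm (g _ * x))) = _ - g _ * g _
  rw [map_mul, AlgEquiv.symm_apply_apply]
  erw [CliffordAlgebra.contractLeft_ι_mul]
  rw [map_sub, map_smul, map_mul, AlgEquiv.apply_symm_apply]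
  rfl

lemma Dop_basisGen_mul (i j : GIdx L n) (x : E) :
    Dop g i (basisGen g j * x) = (if i = j then x else 0) - basisGen g j * Dop g i x := by
  rw [basisGen, Dop_gen_mul]
  simp [Pi.single_apply]

@[simp] lemma Dop_one (i : GIdx L n) : Dop g i (1 : E) = 0 := by
  change g (CliffordAlgebra.contractLeft _ (g.symm 1)) = 0
  rw [map_one, CliffordAlgebra.contractLeft_one, map_zero]

lemma Dop_basisGen (i j : GIdx L n) :
    Dop g i (basisGen g j) = if i = j then 1 else 0 := by
  simpa using Dop_basisGen_mul g i j 1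

lemma parity_Dop (i : GIdx L n) (x : E) : parity g (Dop g i x) = -Dop g i (parity g x) := by
  induction x using gen_induction g with
  | one => simp
  | add x y hx hy => simp [hx, hy]; abel
  | smul c x hx => simp [hx]
  | mul j x hx =>
    rw [Dop_basisGen_mul, map_mul, map_sub, map_mul, parity_basisGen, hx,
      neg_mul (basisGen g j) (parity g x), map_neg, Dop_basisGen_mul]
    split_ifs <;> simp

lemma Dop_mul (i : GIdx L n) (x y : E) :
    Dop g i (x * y) = Dop g i x * y + parity g x * Dop g i y := by
  induction x using gen_induction g with
  | one => simp
  | add x z hx hz => simp [hx, hz, add_mul]; abel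
  | smul c x hx => simp [hx]
  | mul j x hx =>
    rw [mul_assoc, Dop_basisGen_mul, hx, Dop_basisGen_mul, map_mul, parity_basisGen]
    split_ifs <;> simp [sub_mul, mul_add, mul_assoc] <;> abel

lemma Dop_Dop (i : GIdx L n) (x : E) : Dop g i (Dop g i x) = 0 := by
  induction x using gen_induction g with
  | one => simp
  | add x y hx hy => simp [hx, hy]
  | smul c x hx => simp [hx]
  | mul j x hx =>
    rw [Dop_basisGen_mul, map_sub, Dop_basisGen_mul, hx]
    split_ifs <;> simp

lemma Dop_comm (i j : GIdx L n) (x : E) : Dop g i (Dop g j x) = -Dop g j (Dop g i x) := by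
  induction x using gen_induction g with
  | one => simp
  | add x y hx hy => simp [hx, hy]; abel
  | smul c x hx => simp [hx]
  | mul k x hx =>
    simp only [Dop_basisGen_mul, map_sub, hx]
    split_ifs <;> simp
    abel

lemma foldl_Dϑ_sub (l : List (Fin n)) (x y : E) :
    l.foldl (fun w k => Dϑ g k w) (x - y)
      = l.foldl (fun w k => Dϑ g k w) x - l.foldl (fun w k => Dϑ g k w) y := by
  induction l generalizing x y with
  | nil => rfl
  | cons a l ih => simp [ih]

lemma foldl_Dϑ_smul (l : List (Fin n)) (c : ℂ) (x : E) :
    l.foldl (fun w k => Dϑ g k w) (c • x) = c • l.foldl (fun w k => Dϑ g k w) x := by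
  induction l generalizing x with
  | nil => rfl
  | cons a l ih => simp [ih]

lemma foldl_Dϑ_zero (l : List (Fin n)) :
    l.foldl (fun w k => Dϑ g k w) (0 : E) = 0 := by
  simpa using foldl_Dϑ_smul g l 0 0

lemma foldl_Dϑ_eq_zero {l : List (Fin n)} {k : Fin n} (hk : k ∈ l) {x : E}
    (hx : Dϑ g k x = 0) : l.foldl (fun w k => Dϑ g k w) x = 0 := by
  induction l generalizing x with
  | nil => simp at hk
  | cons a l ih =>
    rw [List.foldl_cons]
    rcases List.mem_cons.1 hk with rfl | hk
    · rw [hx, foldl_Dϑ_zero]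
    · refine ih hk ?_
      unfold Dϑ at *
      rw [Dop_comm, hx, map_zero, neg_zero]

/-- The Berezin integral depends only on one of the partial derivatives. -/
lemma Bϑ_congr {k : Fin n} {x y : E} (h : Dϑ g k x = Dϑ g k y) : Bϑ g x = Bϑ g y := by
  have : (List.finRange n).foldl (fun w k => Dϑ g k w) (x - y) = 0 :=
    foldl_Dϑ_eq_zero g (List.mem_finRange k) (by rw [map_sub, h, sub_self])
  rw [foldl_Dϑ_sub, sub_eq_zero] at this
  rw [Bϑ, Bϑ, this]

lemma Bϑ_smul (c : ℂ) (x : E) : Bϑ g (c • x) = c • Bϑ g x := by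
  rw [Bϑ, Bϑ, foldl_Dϑ_smul, map_smul]

end Derivations

section Determinants

variable {k : ℕ}

lemma exists_central_lift {ι κ : Type*} {M : Matrix ι κ E} (hM : ∀ i j, parity g (M i j) = M i j) :
    ∃ M' : Matrix ι κ (Subring.center E), M = M'.map (Subring.center E).subtype :=
  ⟨fun i j => ⟨M i j, Subring.mem_center_iff.2 fun y => (even_mul_comm g (hM i j) y).symm⟩, rfl⟩

omit [NormedAlgebra ℂ E] in
lemma detE_map_center (M : Matrix (Fin k) (Fin k) (Subring.center E)) :
    detE (M.map (Subring.center E).subtype) = (M.det : E) := by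
  rw [← Subring.subtype_apply, Matrix.det_apply, detE, map_sum]
  refine Finset.sum_congr rfl fun σ _ => ?_
  rw [← List.prod_ofFn, Units.smul_def, map_zsmul, map_list_prod, List.map_ofFn]
  rfl

lemma detE_mul {A B : Matrix (Fin k) (Fin k) E} (hA : ∀ i j, parity g (A i j) = A i j)
    (hB : ∀ i j, parity g (B i j) = B i j) : detE (A * B) = detE A * detE B := by
  obtain ⟨A, rfl⟩ := exists_central_lift g hA
  obtain ⟨B, rfl⟩ := exists_central_lift g hB
  rw [← Matrix.map_mul, detE_map_center, detE_map_center, detE_map_center, Matrix.det_mul]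
  rfl

omit [NormedAlgebra ℂ E] in
lemma detE_one : detE (1 : Matrix (Fin k) (Fin k) E) = 1 := by
  have := detE_map_center (E := E) (1 : Matrix (Fin k) (Fin k) _)
  rw [Matrix.map_one _ (map_zero _) (map_one _), Matrix.det_one] at this
  exact this

lemma map_detE (Φ : E →ₐ[ℂ] E) (M : Matrix (Fin k) (Fin k) E) :
    Φ (detE M) = detE (M.map Φ) := by
  simp only [detE, map_sum, map_zsmul, map_list_prod, List.map_ofFn]
  rfl

lemma parity_detE {M : Matrix (Fin k) (Fin k) E} (hM : ∀ i j, parity g (M i j) = M i j) :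
    parity g (detE M) = detE M := by
  rw [map_detE]
  congr 1
  ext i j
  exact hM i j

lemma detE_mul_detE_inverse {A P : Matrix (Fin k) (Fin k) E}
    (hA : ∀ i j, parity g (A i j) = A i j) (hP : ∀ i j, parity g (P i j) = P i j)
    (h : A * P = 1) : detE A * detE P = 1 := by
  rw [← detE_mul g hA hP, h, detE_one]

lemma exists_inverse {M : Matrix (Fin k) (Fin k) E} (hM : ∀ i j, parity g (M i j) = M i j)
    {s : E} (hs : detE M * s = 1) : ∃ N : Matrix (Fin k) (Fin k) E, M * N = 1 ∧ N * M = 1 := by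
  have hs' := parity_inverse_elem g (parity_detE g hM) hs
  obtain ⟨M, rfl⟩ := exists_central_lift g hM
  have hu : IsUnit M.det := by
    refine IsUnit.of_mul_eq_one
      ⟨s, Subring.mem_center_iff.2 fun y => (even_mul_comm g hs' y).symm⟩ (Subtype.ext ?_)
    rw [detE_map_center] at hs
    exact hs
  refine ⟨(M⁻¹).map (Subring.center E).subtype, ?_, ?_⟩
  · rw [← Matrix.map_mul, Matrix.mul_nonsing_inv _ hu, Matrix.map_one _ (map_zero _) (map_one _)]
  · rw [← Matrix.map_mul, Matrix.nonsing_inv_mul _ hu, Matrix.map_one _ (map_zero _) (map_one _)]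

lemma detE_of_col {M : Matrix (Fin k) (Fin k) E} (hM : ∀ i j, parity g (M i j) = M i j)
    (j : Fin k) (h : ∀ i j', j' ≠ j → M i j' = (1 : Matrix (Fin k) (Fin k) E) i j') :
    detE M = M j j := by
  obtain ⟨M, rfl⟩ := exists_central_lift g hM
  have : M = Matrix.updateCol 1 j (fun i => M i j) := by
    ext i j'
    by_cases hj : j' = j
    · subst hj; simp
    · rw [Matrix.updateCol_ne hj]
      have := h i j' hj
      rw [Matrix.map_apply, Subring.subtype_apply] at this
      rw [this]
      simp only [Matrix.one_apply]
      split_ifs <;> rfl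
  rw [detE_map_center, this, ← Matrix.cramer_apply, Matrix.cramer_one]
  simp

lemma detE_of_row {M : Matrix (Fin k) (Fin k) E} (hM : ∀ i j, parity g (M i j) = M i j)
    (i : Fin k) (h : ∀ i' j, i' ≠ i → M i' j = (1 : Matrix (Fin k) (Fin k) E) i' j) :
    detE M = M i i := by
  have h₁ : detE M = detE M.transpose := by
    obtain ⟨M, rfl⟩ := exists_central_lift g hM
    rw [← Matrix.transpose_map, detE_map_center, detE_map_center, Matrix.det_transpose]
  rw [h₁, detE_of_col g (M := M.transpose) (fun i j => hM j i) i]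
  · rfl
  · intro i' j hj
    rw [Matrix.transpose_apply, h _ _ hj]
    simp only [Matrix.one_apply, eq_comm]

variable {ι κ μ : Type*} [Fintype κ]

lemma parity_mul_apply_even {A : Matrix ι κ E} {B : Matrix κ μ E}
    (hA : ∀ i j, parity g (A i j) = A i j) (hB : ∀ i j, parity g (B i j) = B i j) (i j) :
    parity g ((A * B) i j) = (A * B) i j := by
  simp [Matrix.mul_apply, hA, hB]

lemma parity_mul_apply_odd {A : Matrix ι κ E} {B : Matrix κ μ E}
    (hA : ∀ i j, parity g (A i j) = -A i j) (hB : ∀ i j, parity g (B i j) = -B i j) (i j) :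
    parity g ((A * B) i j) = (A * B) i j := by
  simp [Matrix.mul_apply, hA, hB]

lemma parity_mul_apply_odd_even {A : Matrix ι κ E} {B : Matrix κ μ E}
    (hA : ∀ i j, parity g (A i j) = -A i j) (hB : ∀ i j, parity g (B i j) = B i j) (i j) :
    parity g ((A * B) i j) = -(A * B) i j := by
  simp [Matrix.mul_apply, hA, hB]

lemma parity_mul_apply_even_odd {A : Matrix ι κ E} {B : Matrix κ μ E}
    (hA : ∀ i j, parity g (A i j) = A i j) (hB : ∀ i j, parity g (B i j) = -B i j) (i j) :
    parity g ((A * B) i j) = -(A * B) i j := by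
  simp [Matrix.mul_apply, hA, hB]

lemma parity_add_apply {A B : Matrix ι μ E}
    (hA : ∀ i j, parity g (A i j) = A i j) (hB : ∀ i j, parity g (B i j) = B i j) (i j) :
    parity g ((A + B) i j) = (A + B) i j := by
  simp [hA, hB]

lemma parity_sub_apply {A B : Matrix ι μ E}
    (hA : ∀ i j, parity g (A i j) = A i j) (hB : ∀ i j, parity g (B i j) = B i j) (i j) :
    parity g ((A - B) i j) = (A - B) i j := by
  simp [hA, hB]

omit [Fintype κ] in
lemma parity_one_apply [DecidableEq κ] (i j : κ) :
    parity g ((1 : Matrix κ κ E) i j) = (1 : Matrix κ κ E) i j := by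
  rw [Matrix.one_apply]; split_ifs <;> simp

lemma detE_one_add_single_mul (i : Fin m) (k : Fin n) {ξ : E} (hξ : parity g ξ = -ξ)
    {f : Matrix (Fin n) (Fin m) E} (hf : ∀ i j, parity g (f i j) = -f i j) :
    detE (1 + Matrix.single i k ξ * f) * detE (1 + f * Matrix.single i k ξ) = 1 := by
  have hs : ∀ a b, parity g (Matrix.single i k ξ a b) = -Matrix.single i k ξ a b := by
    intro a b
    simp only [Matrix.single_apply]
    split_ifs <;> simp [hξ]
  rw [detE_of_row g (parity_add_apply g (parity_one_apply g) (parity_mul_apply_odd g hs hf)) i,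
    detE_of_col g (parity_add_apply g (parity_one_apply g) (parity_mul_apply_odd g hf hs)) k]
  · simp only [Matrix.add_apply, Matrix.one_apply_eq, Matrix.single_mul_apply_same,
      Matrix.mul_single_apply_same]
    have h₁ : ξ * f k i * (f k i * ξ) = 0 := by
      rw [mul_assoc, ← mul_assoc (f k i), odd_sq g (hf k i)]; simp
    rw [mul_add, add_mul, add_mul, h₁, odd_mul_odd g hξ (hf k i)]
    simp
  · intro a b hb
    simp [Matrix.mul_single_apply_of_ne _ _ _ _ _ hb]
  · intro a b ha
    simp [Matrix.single_mul_apply_of_ne _ _ _ _ _ ha]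

/-- The determinant identity for products of odd matrices. -/
lemma detE_one_add_odd_mul_odd {c : Matrix (Fin m) (Fin n) E} {f : Matrix (Fin n) (Fin m) E}
    (hc : ∀ i j, parity g (c i j) = -c i j) (hf : ∀ i j, parity g (f i j) = -f i j) :
    detE (1 + c * f) * detE (1 + f * c) = 1 := by
  let P : Matrix (Fin m) (Fin n) E → Prop := fun c => (∀ i j, parity g (c i j) = -c i j) ∧
    ∀ f : Matrix (Fin n) (Fin m) E, (∀ i j, parity g (f i j) = -f i j) →
      detE (1 + c * f) * detE (1 + f * c) = 1
  suffices h : P c from h.2 f hf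
  have hadd : ∀ c₁ c₂, P c₁ → P c₂ → P (c₁ + c₂) := by
    rintro c₁ c₂ ⟨h₁, H₁⟩ ⟨h₂, H₂⟩
    refine ⟨fun i j => by simp [h₁, h₂]; abel, fun f hf => ?_⟩
    have e₁ := parity_add_apply g (parity_one_apply g) (parity_mul_apply_odd g h₁ hf)
    have e₂ := parity_add_apply g (parity_one_apply g) (parity_mul_apply_odd g hf h₁)
    obtain ⟨N, hN, hN'⟩ := exists_inverse g e₁ (H₁ f hf)
    have eN := parity_inverse g e₁ hN hN'
    have hf' := parity_mul_apply_odd_even g hf eN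
    have k₁ : 1 + (c₁ + c₂) * f = (1 + c₂ * (f * N)) * (1 + c₁ * f) := by
      rw [add_mul 1 (c₂ * (f * N)), Matrix.mul_assoc c₂, Matrix.mul_assoc f, hN', Matrix.mul_one,
        one_mul, Matrix.add_mul]
      abel
    have k₂ : 1 + f * (c₁ + c₂) = (1 + f * c₁) * (1 + (f * N) * c₂) := by
      have : (1 + f * c₁) * (f * N) = f := by
        calc (1 + f * c₁) * (f * N) = f * ((1 + c₁ * f) * N) := by
              simp only [Matrix.add_mul, Matrix.mul_add, Matrix.mul_assoc, Matrix.one_mul]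
          _ = f := by rw [hN, Matrix.mul_one]
      rw [mul_add, mul_one, ← Matrix.mul_assoc (1 + f * c₁) (f * N), this, Matrix.mul_add]
      abel
    rw [k₁, k₂, detE_mul g (parity_add_apply g (parity_one_apply g)
      (parity_mul_apply_odd g h₂ hf')) e₁, detE_mul g e₂ (parity_add_apply g (parity_one_apply g)
      (parity_mul_apply_odd g hf' h₂)), mul_assoc, ← mul_assoc (detE (1 + c₁ * f)), H₁ f hf,
      one_mul, H₂ _ hf']
  rw [Matrix.matrix_eq_sum_single c]
  refine Finset.sum_induction _ P hadd ⟨by simp, fun f _ => by simp [detE_one]⟩ fun i _ => ?_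
  refine Finset.sum_induction _ P hadd ⟨by simp, fun f _ => by simp [detE_one]⟩ fun j _ => ?_
  refine ⟨fun a b => ?_, fun f hf => detE_one_add_single_mul g i j (hc i j) hf⟩
  simp only [Matrix.single_apply]
  split_ifs <;> simp [hc]

/-- Multiplicativity of the superdeterminant for left multiplication by a supermatrix
`[[a, c], [0, b]]`. -/
lemma sdet_mul {a A P P' : Matrix (Fin m) (Fin m) E} {b B : Matrix (Fin n) (Fin n) E}
    {c C : Matrix (Fin m) (Fin n) E} {D : Matrix (Fin n) (Fin m) E} {a' : Matrix (Fin m) (Fin m) E}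
    {s s' sb : E}
    (ha : ∀ i j, parity g (a i j) = a i j) (hA : ∀ i j, parity g (A i j) = A i j)
    (hb : ∀ i j, parity g (b i j) = b i j) (hB : ∀ i j, parity g (B i j) = B i j)
    (hc : ∀ i j, parity g (c i j) = -c i j) (hC : ∀ i j, parity g (C i j) = -C i j)
    (hD : ∀ i j, parity g (D i j) = -D i j)
    (haa' : a * a' = 1) (ha'a : a' * a = 1) (hAP : A * P = 1) (hPA : P * A = 1)
    (hs : detE (B - D * P * C) * s = 1) (hsb : detE b * sb = 1)
    (hP' : (a * A + c * D) * P' = 1)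
    (hs' : detE (b * B - b * D * P' * (a * C + c * B)) * s' = 1) :
    detE (a * A + c * D) * s' = detE a * (sb * (detE A * s)) := by
  have ha' := parity_inverse g ha haa' ha'a
  have hP := parity_inverse g hA hAP hPA
  have hf := parity_mul_apply_odd_even g hD hP
  have hc' := parity_mul_apply_even_odd g ha' hc
  have hX := parity_sub_apply g hB (parity_mul_apply_odd g hf hC)
  have hN := parity_add_apply g (parity_one_apply g) (parity_mul_apply_odd g hc' hf)
  have hW := parity_add_apply g (parity_one_apply g) (parity_mul_apply_odd g hf hc')
  have hNW := detE_one_add_odd_mul_odd g hc' hf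
  have hfact : a * A + c * D = a * ((1 + a' * c * (D * P)) * A) := by
    simp only [Matrix.add_mul, Matrix.mul_add, Matrix.one_mul, Matrix.mul_assoc, hPA,
      Matrix.mul_one]
    rw [← Matrix.mul_assoc a a', haa', Matrix.one_mul]
  have hdetA : detE (a * A + c * D) = detE a * (detE (1 + a' * c * (D * P)) * detE A) := by
    rw [hfact, detE_mul g ha (parity_mul_apply_even g hN hA), detE_mul g hN hA]
  set f := D * P with hfdef
  set c' := a' * c with hcdef
  have hDf : D = f * A := by rw [hfdef, Matrix.mul_assoc, hPA, Matrix.mul_one]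
  have hac : a * c' = c := by rw [hcdef, ← Matrix.mul_assoc, haa', Matrix.one_mul]
  clear_value f c'
  have hkey : (1 + f * c') * (B - D * P' * (a * C + c * B)) = B - f * C := by
    have h₁ : (1 + f * c') * (D * P') * a = f := by
      have h₂ : (1 + c' * f) * (A * P' * a) = 1 := by
        calc (1 + c' * f) * (A * P' * a) = a' * ((a * ((1 + c' * f) * A)) * P') * a := by
              simp only [← Matrix.mul_assoc, ha'a, Matrix.one_mul]
          _ = 1 := by rw [← hfact, hP', Matrix.mul_one, ha'a]
      calc (1 + f * c') * (D * P') * a = f * ((1 + c' * f) * (A * P' * a)) := by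
            rw [hDf]
            simp only [Matrix.add_mul, Matrix.mul_add, Matrix.mul_assoc, Matrix.one_mul]
        _ = f := by rw [h₂, Matrix.mul_one]
    have h₃ : a * C + c * B = a * (C + c' * B) := by
      rw [Matrix.mul_add, ← Matrix.mul_assoc, hac]
    rw [h₃, Matrix.mul_sub, ← Matrix.mul_assoc, ← Matrix.mul_assoc, h₁]
    simp only [Matrix.add_mul, Matrix.mul_add, Matrix.one_mul, Matrix.mul_assoc]
    abel
  have hP'e : ∀ i j, parity g (P' i j) = P' i j := by
    have hM : ∀ i j, parity g ((a * A + c * D) i j) = (a * A + c * D) i j :=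
      parity_add_apply g (parity_mul_apply_even g ha hA) (parity_mul_apply_odd g hc hD)
    obtain ⟨M, hM'⟩ := exists_central_lift g hM
    have hu : ∃ t, detE (a * A + c * D) * t = 1 := by
      have h₁ := detE_mul_detE_inverse g ha ha' haa'
      have h₂ := detE_mul_detE_inverse g hA hP hAP
      refine ⟨detE P * detE (1 + f * c') * detE a', ?_⟩
      rw [hdetA]
      calc _ = detE a * (detE (1 + c' * f) * (detE A * detE P) * detE (1 + f * c')) * detE a' := by
            simp only [mul_assoc]
        _ = 1 := by rw [h₂, mul_one, hNW, mul_one, h₁]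
    obtain ⟨t, ht⟩ := hu
    obtain ⟨N, hN₁, hN₂⟩ := exists_inverse g hM ht
    have : P' = N := by
      calc P' = N * (a * A + c * D) * P' := by rw [hN₂, Matrix.one_mul]
        _ = N := by rw [Matrix.mul_assoc, hP', Matrix.mul_one]
    rw [this]
    exact parity_inverse g hM hN₁ hN₂
  have hZ : ∀ i j, parity g ((B - D * P' * (a * C + c * B)) i j)
      = (B - D * P' * (a * C + c * B)) i j := by
    refine parity_sub_apply g hB (parity_mul_apply_odd g (parity_mul_apply_odd_even g hD hP'e) ?_)
    intro i j
    rw [Matrix.add_apply, map_add, parity_mul_apply_even_odd g ha hC,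
      parity_mul_apply_odd_even g hc hB]
    abel
  have hY : b * B - b * D * P' * (a * C + c * B) = b * (B - D * P' * (a * C + c * B)) := by
    rw [Matrix.mul_sub]; simp only [Matrix.mul_assoc]
  rw [hY, detE_mul g hb hZ] at hs'
  have hw : detE (1 + f * c') * detE (B - D * P' * (a * C + c * B)) = detE (B - f * C) := by
    rw [← detE_mul g hW hZ, hkey]
  have ew := parity_detE g hW
  have eb := parity_detE g hb
  have ez := parity_detE g hZ
  have ex := parity_detE g hX
  have eA := parity_detE g hA
  have esb := parity_inverse_elem g eb hsb
  have es := parity_inverse_elem g ex hs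
  have hs'w : s' = detE (1 + f * c') * (sb * s) := by
    have e₁ : detE (1 + f * c') * (sb * s) *
        (detE b * detE (B - D * P' * (a * C + c * B))) = 1 := by
      calc _ = detE (1 + f * c') * (detE b * detE (B - D * P' * (a * C + c * B))) * (sb * s) := by
            rw [mul_assoc, even_mul_comm g (x := sb * s) (by rw [map_mul, esb, es]), ← mul_assoc]
        _ = detE b * (detE (1 + f * c') * detE (B - D * P' * (a * C + c * B))) * (sb * s) := by
            rw [← mul_assoc (detE (1 + f * c')), even_mul_comm g ew (detE b), mul_assoc (detE b)]
        _ = detE b * (detE (B - f * C) * sb) * s := by rw [hw]; simp only [mul_assoc]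
        _ = 1 := by rw [even_mul_comm g ex, ← mul_assoc, hsb, one_mul, hs]
    calc s' = _ * (detE b * detE (B - D * P' * (a * C + c * B))) * s' := by rw [e₁, one_mul]
      _ = _ := by rw [mul_assoc, hs', mul_one]
  rw [hdetA, hs'w]
  calc _ = detE a * (detE (1 + c' * f) * (detE A * detE (1 + f * c')) * (sb * s)) := by
        simp only [mul_assoc]
    _ = detE a * (detE A * (sb * s)) := by
        rw [even_mul_comm g eA, ← mul_assoc (detE (1 + c' * f)), hNW, one_mul]
    _ = _ := by rw [← mul_assoc (detE A), even_mul_comm g eA, mul_assoc]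

end Determinants

section Body

@[simp] lemma πB_basisGen (i : GIdx L n) : πB g (basisGen g i) = 0 := by
  change ExteriorAlgebra.algebraMapInv (g.symm (g (ExteriorAlgebra.ι ℂ _))) = 0
  rw [AlgEquiv.symm_apply_apply, ExteriorAlgebra.algebraMapInv, ExteriorAlgebra.lift_ι_apply]
  rfl

lemma πB_of_odd {x : E} (hx : parity g x = -x) : πB g x = 0 := by
  have := congrArg (πB g) (odd_sq g hx)
  simpa using this

lemma evalKill_basisGen (keep : GIdx L n → Bool) (i : GIdx L n) :
    evalKill g keep (basisGen g i) = if keep i then basisGen g i else 0 := by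
  change g (CliffordAlgebra.map _ (g.symm (g (CliffordAlgebra.ι _ _)))) = _
  rw [AlgEquiv.symm_apply_apply, CliffordAlgebra.map_apply_ι]
  have h : keepLin L n keep (Pi.single i 1) = if keep i then Pi.single i 1 else 0 := by
    ext j
    simp only [keepLin, LinearMap.coe_mk, AddHom.coe_mk, Pi.single_apply]
    by_cases hj : j = i
    · subst hj; split_ifs <;> simp_all
    · split_ifs <;> simp [hj]
  change g (CliffordAlgebra.ι _ (keepLin L n keep (Pi.single i 1))) = _
  rw [h]
  split_ifs
  · rfl
  · simp

/-- Taylor formula for a substitution which changes a single generator. -/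
lemma substitute_single {i : GIdx L n} {Φ : E →ₐ[ℂ] E}
    (hΦ : ∀ j, j ≠ i → Φ (basisGen g j) = basisGen g j)
    (hi : parity g (Φ (basisGen g i)) = -Φ (basisGen g i)) (x : E) :
    Φ x = x + (Φ (basisGen g i) - basisGen g i) * Dop g i x := by
  have hd : parity g (Φ (basisGen g i) - basisGen g i) = -(Φ (basisGen g i) - basisGen g i) := by
    simp [hi]; abel
  induction x using gen_induction g with
  | one => simp
  | add x y hx hy => simp only [map_add, hx, hy, mul_add]; abel
  | smul c x hx => simp [hx]
  | mul j x hx =>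
    rw [map_mul, hx, Dop_basisGen_mul]
    by_cases hj : i = j
    · subst hj
      have h₁ : Φ (basisGen g i) * ((Φ (basisGen g i) - basisGen g i) * Dop g i x)
          = -((Φ (basisGen g i) - basisGen g i) * (basisGen g i * Dop g i x)) := by
        rw [← mul_assoc, ← mul_assoc, ← neg_mul]
        congr 1
        rw [mul_sub, sub_mul, odd_sq g hi, basisGen_sq]
        simp
      rw [if_pos rfl, mul_add, h₁]
      noncomm_ring
    · rw [if_neg hj, hΦ j (Ne.symm hj), mul_add, ← mul_assoc,
        odd_mul_odd g (parity_basisGen g j) hd]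
      noncomm_ring

lemma parity_evalKill (keep : GIdx L n → Bool) (x : E) :
    parity g (evalKill g keep x) = evalKill g keep (parity g x) := by
  have : (parity g).comp (evalKill g keep) = (evalKill g keep).comp (parity g) :=
    algHom_ext' g fun i => by
      simp only [AlgHom.comp_apply, parity_basisGen, evalKill_basisGen, map_neg]
      split_ifs <;> simp
  exact DFunLike.congr_fun this x

lemma isUnit_of_isUnit_evalKill {i : GIdx L n} {x : E} (hx : parity g x = x)
    (h : IsUnit (evalKill g (fun j : GIdx L n => decide (j ≠ i)) x)) : IsUnit x := by
  have hk := substitute_single g (i := i) (Φ := evalKill g (fun j : GIdx L n => decide (j ≠ i)))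
    (fun j hj => by simp [evalKill_basisGen, hj]) (by simp [evalKill_basisGen]) x
  have h0 : evalKill g (fun j : GIdx L n => decide (j ≠ i)) (basisGen g i) = 0 := by
    simp [evalKill_basisGen]
  rw [h0, zero_sub, neg_mul, ← sub_eq_add_neg] at hk
  have hx' : x = basisGen g i * Dop g i x + evalKill g (fun j : GIdx L n => decide (j ≠ i)) x := by
    rw [hk]; abel
  have hodd : parity g (Dop g i x) = -Dop g i x := by rw [parity_Dop, hx]
  have hnil : IsNilpotent (basisGen g i * Dop g i x) := by
    refine ⟨2, ?_⟩
    rw [pow_two, mul_assoc, ← mul_assoc (Dop g i x), odd_mul_odd g hodd (parity_basisGen g i)]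
    simp only [neg_mul, mul_assoc, odd_sq g hodd, mul_zero, neg_zero]
  rw [hx']
  refine (hnil.isUnit_add_right_of_commute h ?_)
  exact even_mul_comm g (by simp [hodd]) _

lemma isUnit_of_πB_ne_zero {x : E} (hx : parity g x = x) (h : πB g x ≠ 0) : IsUnit x := by
  have key : ∀ l : List (GIdx L n),
      IsUnit (evalKill g (fun j : GIdx L n => l.all fun a => decide (j ≠ a)) x) → IsUnit x := by
    intro l
    induction l with
    | nil =>
      have : evalKill g (fun j : GIdx L n =>
          ([] : List (GIdx L n)).all fun a => decide (j ≠ a)) = AlgHom.id ℂ E :=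
        algHom_ext' g fun i => by simp [evalKill_basisGen]
      rw [this]; exact id
    | cons a l ih =>
      intro hu
      apply ih
      apply isUnit_of_isUnit_evalKill g (i := a) (by rw [parity_evalKill, hx])
      have : evalKill g (fun j : GIdx L n => (a :: l).all fun a => decide (j ≠ a)) =
          (evalKill g (fun j : GIdx L n => decide (j ≠ a))).comp
            (evalKill g (fun j : GIdx L n => l.all fun a => decide (j ≠ a))) :=
        algHom_ext' g fun i => by
          rw [evalKill_basisGen, List.all_cons, AlgHom.comp_apply, evalKill_basisGen]
          rcases Bool.eq_false_or_eq_true (l.all fun a => decide (i ≠ a)) with h₂ | h₂ <;>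
            rw [h₂] <;> simp [evalKill_basisGen]
      rw [this] at hu
      exact hu
  apply key Finset.univ.toList
  have : evalKill g (fun j : GIdx L n =>
      (Finset.univ : Finset (GIdx L n)).toList.all fun a => decide (j ≠ a)) =
      (Algebra.ofId ℂ E).comp (πB g) := algHom_ext' g fun i => by simp [evalKill_basisGen]
  rw [this]
  exact (IsUnit.mk0 _ h).map (algebraMap ℂ E)

end Body

section Substitution

/-- The algebra endomorphisms of `E` replacing the generators `ϑ` by odd elements. -/
structure IsSubst (Φ : E →ₐ[ℂ] E) : Prop where
  fix : ∀ i, notϑ i = true → Φ (basisGen g i) = basisGen g i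
  odd : ∀ k, parity g (Φ (ϑg g k)) = -Φ (ϑg g k)

/-- The matrix of odd derivatives `∂Φ(ϑ_k)/∂ϑ_l`. -/
def jac (Φ : E →ₐ[ℂ] E) : Matrix (Fin n) (Fin n) E :=
  Matrix.of fun l k => Dϑ g l (Φ (ϑg g k))

@[simp] lemma parity_ϑg (k : Fin n) : parity g (ϑg g k) = -ϑg g k := parity_basisGen g _

lemma Dϑ_ϑg (l k : Fin n) : Dϑ g l (ϑg g k) = (1 : Matrix (Fin n) (Fin n) E) l k := by
  rw [Matrix.one_apply]
  refine (Dop_basisGen g _ _).trans ?_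
  simp

/-- The images of the generators under the substitution `ϑ ↦ w`. -/
def substGen (w : Fin n → E) : GIdx L n → E
  | .inr (.inr (.inr k)) => w k
  | i => basisGen g i

lemma parity_substGen {w : Fin n → E} (hw : ∀ k, parity g (w k) = -w k) (i : GIdx L n) :
    parity g (substGen g w i) = -substGen g w i := by
  rcases i with i | i | i | i <;> simp [substGen, hw]

lemma exists_subst {w : Fin n → E} (hw : ∀ k, parity g (w k) = -w k) :
    ∃ Φ : E →ₐ[ℂ] E, IsSubst g Φ ∧ ∀ k, Φ (ϑg g k) = w k := by
  let f : (GIdx L n → ℂ) →ₗ[ℂ] E := Fintype.linearCombination ℂ (substGen g w)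
  have hf : ∀ v, f v * f v = 0 := fun v => odd_sq g <| by
    simp only [f, Fintype.linearCombination_apply, map_sum, map_smul, parity_substGen g hw,
      smul_neg, Finset.sum_neg_distrib]
  let Φ : E →ₐ[ℂ] E := (ExteriorAlgebra.lift ℂ ⟨f, hf⟩).comp g.symm.toAlgHom
  have hΦ : ∀ i, Φ (basisGen g i) = substGen g w i := by
    intro i
    change ExteriorAlgebra.lift ℂ ⟨f, hf⟩ (g.symm (g (ExteriorAlgebra.ι ℂ _))) = _
    rw [AlgEquiv.symm_apply_apply, ExteriorAlgebra.lift_ι_apply]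
    simp [f, Fintype.linearCombination_apply_single]
  have hϑ : ∀ k, Φ (ϑg g k) = w k := fun k => hΦ _
  refine ⟨Φ, ⟨fun i hi => ?_, fun k => by rw [hϑ, hw]⟩, hϑ⟩
  rw [hΦ]
  rcases i with i | i | i | i <;> simp_all [substGen, notϑ]

variable {g}

lemma subst_ext {Φ Ψ : E →ₐ[ℂ] E} (hΦ : IsSubst g Φ) (hΨ : IsSubst g Ψ)
    (h : ∀ k, Φ (ϑg g k) = Ψ (ϑg g k)) : Φ = Ψ := by
  refine algHom_ext' g fun i => ?_
  rcases i with i | i | i | i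
  · rw [hΦ.fix _ rfl, hΨ.fix _ rfl]
  · rw [hΦ.fix _ rfl, hΨ.fix _ rfl]
  · rw [hΦ.fix _ rfl, hΨ.fix _ rfl]
  · exact h i

lemma isSubst_id : IsSubst g (AlgHom.id ℂ E) := ⟨fun _ _ => rfl, fun _ => by simp⟩

lemma IsSubst.parity_basisGen {Φ : E →ₐ[ℂ] E} (hΦ : IsSubst g Φ) (i : GIdx L n) :
    parity g (Φ (basisGen g i)) = -Φ (basisGen g i) := by
  rcases i with i | i | i | i
  · rw [hΦ.fix _ rfl, SuperCalc.parity_basisGen]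
  · rw [hΦ.fix _ rfl, SuperCalc.parity_basisGen]
  · rw [hΦ.fix _ rfl, SuperCalc.parity_basisGen]
  · exact hΦ.odd i

lemma IsSubst.parity_apply {Φ : E →ₐ[ℂ] E} (hΦ : IsSubst g Φ) (x : E) :
    parity g (Φ x) = Φ (parity g x) := by
  have : (parity g).comp Φ = Φ.comp (parity g) :=
    algHom_ext' g fun i => by simp [hΦ.parity_basisGen]
  exact DFunLike.congr_fun this x

lemma IsSubst.comp {Φ Ψ : E →ₐ[ℂ] E} (hΦ : IsSubst g Φ) (hΨ : IsSubst g Ψ) :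
    IsSubst g (Φ.comp Ψ) :=
  ⟨fun i hi => by rw [AlgHom.comp_apply, hΨ.fix i hi, hΦ.fix i hi],
    fun k => by rw [AlgHom.comp_apply, hΦ.parity_apply, hΨ.odd, map_neg]⟩

lemma IsSubst.πB_apply {Φ : E →ₐ[ℂ] E} (hΦ : IsSubst g Φ) (x : E) : πB g (Φ x) = πB g x := by
  have : (πB g).comp Φ = πB g :=
    algHom_ext' g fun i => by simp [πB_of_odd g (hΦ.parity_basisGen i)]
  exact DFunLike.congr_fun this x

lemma IsSubst.parity_jac {Φ : E →ₐ[ℂ] E} (hΦ : IsSubst g Φ) (l k : Fin n) :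
    parity g (jac g Φ l k) = jac g Φ l k := by
  change parity g (Dop g _ _) = Dop g _ _
  rw [parity_Dop, hΦ.odd, map_neg, neg_neg]

lemma Dϑ_basisGen_of_notϑ {i : GIdx L n} (hi : notϑ i = true) (l : Fin n) :
    Dϑ g l (basisGen g i) = 0 := by
  rw [Dϑ, Dop_basisGen, if_neg]
  rintro rfl
  simp [notϑ] at hi

/-- The chain rule for odd derivatives. -/
lemma IsSubst.Dϑ_apply {Φ : E →ₐ[ℂ] E} (hΦ : IsSubst g Φ) (l : Fin n) (x : E) :
    Dϑ g l (Φ x) = ∑ k, jac g Φ l k * Φ (Dϑ g k x) := by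
  induction x using gen_induction g with
  | one => simp [Dϑ]
  | add x y hx hy => simp [hx, hy, mul_add, Finset.sum_add_distrib]
  | smul c x hx => simp [hx, Finset.smul_sum]
  | mul i x hx =>
    have h₁ : Dϑ g l (Φ (basisGen g i)) = ∑ k, jac g Φ l k * Φ (Dϑ g k (basisGen g i)) := by
      by_cases hi : notϑ i = true
      · simp [hΦ.fix i hi, Dϑ_basisGen_of_notϑ hi]
      · obtain ⟨k, rfl⟩ : ∃ k, i = .inr (.inr (.inr k)) := by
          rcases i with i | i | i | i <;> simp_all [notϑ]
        change Dϑ g l (Φ (ϑg g k)) = ∑ k', jac g Φ l k' * Φ (Dϑ g k' (ϑg g k))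
        simp only [Dϑ_ϑg, Matrix.one_apply, jac, Matrix.of_apply]
        simp [apply_ite]
    have h₂ : ∀ (j : Fin n) (y z : E), Dϑ g j (y * z) = Dϑ g j y * z + parity g y * Dϑ g j z :=
      fun j y z => Dop_mul g _ y z
    rw [map_mul, h₂, h₁, hx, hΦ.parity_basisGen, Finset.sum_mul, neg_mul, Finset.mul_sum,
      ← sub_eq_add_neg, ← Finset.sum_sub_distrib]
    refine Finset.sum_congr rfl fun k _ => ?_
    rw [h₂, SuperCalc.parity_basisGen, map_add, map_mul, map_mul, map_neg, ← mul_assoc,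
      ← even_mul_comm g (hΦ.parity_jac l k)]
    noncomm_ring

lemma IsSubst.jac_comp {Φ : E →ₐ[ℂ] E} (hΦ : IsSubst g Φ) (Ψ : E →ₐ[ℂ] E) :
    jac g (Φ.comp Ψ) = jac g Φ * (jac g Ψ).map Φ := by
  ext l k
  simp only [Matrix.mul_apply, Matrix.map_apply]
  exact hΦ.Dϑ_apply l (Ψ (ϑg g k))

lemma jac_id : jac g (AlgHom.id ℂ E) = 1 := by
  ext l k; exact Dϑ_ϑg g l k

end Substitution

section Berezin

/-- The change of variables formula holds for the Berezin integral and the substitution `Φ`. -/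
def BerezinCov (Φ : E →ₐ[ℂ] E) : Prop :=
  IsSubst g Φ ∧ ∃ r, detE (jac g Φ) * r = 1 ∧ ∀ v, Bϑ g (r * Φ v) = Bϑ g v

variable {g}

lemma BerezinCov.comp {Φ Ψ : E →ₐ[ℂ] E} (hΦ : BerezinCov g Φ) (hΨ : BerezinCov g Ψ) :
    BerezinCov g (Φ.comp Ψ) := by
  obtain ⟨sΦ, r, hr, HΦ⟩ := hΦ
  obtain ⟨sΨ, t, ht, HΨ⟩ := hΨ
  have hΦt : detE ((jac g Ψ).map Φ) * Φ t = 1 := by rw [← map_detE, ← map_mul, ht, map_one]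
  have e : ∀ i j, parity g ((jac g Ψ).map Φ i j) = (jac g Ψ).map Φ i j := fun i j => by
    rw [Matrix.map_apply, sΦ.parity_apply, sΨ.parity_jac]
  refine ⟨sΦ.comp sΨ, r * Φ t, ?_, fun v => ?_⟩
  · rw [sΦ.jac_comp, detE_mul g sΦ.parity_jac e, even_mul_comm g (parity_detE g sΦ.parity_jac),
      mul_assoc, ← mul_assoc _ r, hr, one_mul, hΦt]
  · rw [AlgHom.comp_apply, mul_assoc, ← map_mul, HΦ, HΨ]

lemma berezinCov_id : BerezinCov g (AlgHom.id ℂ E) :=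
  ⟨isSubst_id, 1, by rw [jac_id, detE_one, one_mul], fun v => by simp⟩

lemma IsSubst.apply_eq_of_single {Φ : E →ₐ[ℂ] E} (hΦ : IsSubst g Φ) {k : Fin n}
    (hfix : ∀ j, j ≠ k → Φ (ϑg g j) = ϑg g j) (x : E) :
    Φ x = x + (Φ (ϑg g k) - ϑg g k) * Dϑ g k x := by
  refine substitute_single g (i := .inr (.inr (.inr k))) (fun j hj => ?_) (hΦ.odd k) x
  rcases j with j | j | j | j
  · exact hΦ.fix _ rfl
  · exact hΦ.fix _ rfl
  · exact hΦ.fix _ rfl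
  · exact hfix j fun h => hj (by rw [h])

lemma Dϑ_inverse {k : Fin n} {β r : E} (hβ : parity g β = β) (h : β * r = 1)
    (hD : Dϑ g k β = 0) : Dϑ g k r = 0 := by
  have h₁ : Dϑ g k (β * r) = 0 := by rw [h]; exact Dop_one g _
  rw [Dϑ, Dop_mul, hβ] at h₁
  unfold Dϑ at hD
  rw [hD, zero_mul, zero_add] at h₁
  calc Dϑ g k r = r * β * Dϑ g k r := by rw [← even_mul_comm g hβ, h, one_mul]
    _ = 0 := by rw [mul_assoc, Dϑ, h₁, mul_zero]

lemma IsSubst.berezinCov_of_single {Φ : E →ₐ[ℂ] E} (hΦ : IsSubst g Φ) {k : Fin n}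
    (hfix : ∀ j, j ≠ k → Φ (ϑg g j) = ϑg g j) (hk : πB g (jac g Φ k k) ≠ 0) :
    BerezinCov g Φ := by
  obtain ⟨u, hu⟩ := isUnit_of_πB_ne_zero g (hΦ.parity_jac k k) hk
  have hr : jac g Φ k k * ↑u⁻¹ = 1 := by rw [← hu, Units.mul_inv]
  refine ⟨hΦ, ↑u⁻¹, ?_, fun v => ?_⟩
  · rw [detE_of_col g hΦ.parity_jac k, hr]
    intro i j hj
    rw [jac, Matrix.of_apply, hfix j hj, Dϑ_ϑg]
  · apply Bϑ_congr g (k := k)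
    have hr' := parity_inverse_elem g (hΦ.parity_jac k k) hr
    have hD := Dϑ_inverse (hΦ.parity_jac k k) hr (Dop_Dop g _ _)
    have hΦv : Dϑ g k (Φ v) = jac g Φ k k * Dϑ g k v := by
      have h1 : Dϑ g k (ϑg g k) = 1 := by rw [Dϑ_ϑg, Matrix.one_apply_eq]
      have h2 : Dϑ g k (Dϑ g k v) = 0 := Dop_Dop g _ _
      rw [hΦ.apply_eq_of_single hfix v, map_add]
      unfold Dϑ at h1 h2 ⊢
      rw [Dop_mul, h2, mul_zero, add_zero, map_sub, h1, sub_mul, one_mul]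
      exact add_sub_cancel _ _
    unfold Dϑ at hD hΦv ⊢
    rw [Dop_mul, hD, zero_mul, zero_add, hr', hΦv, ← mul_assoc,
      ← even_mul_comm g (hΦ.parity_jac k k), hr, one_mul]

lemma IsSubst.berezinCov_of_diagonal (S : Finset (Fin n)) : ∀ {Φ : E →ₐ[ℂ] E}, IsSubst g Φ →
    (∀ k, k ∉ S → Φ (ϑg g k) = ϑg g k) → ∀ d : Fin n → ℂ, (∀ k, d k ≠ 0) →
    (jac g Φ).map (πB g) = Matrix.diagonal d → BerezinCov g Φ := by
  induction S using Finset.induction_on with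
  | empty =>
    intro Φ hΦ hfix d hd hJ
    rw [subst_ext hΦ isSubst_id fun k => hfix k (Finset.notMem_empty k)]
    exact berezinCov_id
  | insert k S hkS ih =>
    intro Φ hΦ hfix d hd hJ
    have hJ' : ∀ i j, πB g (jac g Φ i j) = Matrix.diagonal d i j := fun i j => by
      rw [← hJ, Matrix.map_apply]
    obtain ⟨u, hu⟩ := isUnit_of_πB_ne_zero g (hΦ.parity_jac k k)
      (by rw [hJ', Matrix.diagonal_apply_eq]; exact hd k)
    obtain ⟨r, hr⟩ : ∃ r, jac g Φ k k * r = 1 := ⟨↑u⁻¹, by rw [← hu, Units.mul_inv]⟩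
    have eβ := hΦ.parity_jac k k
    have er := parity_inverse_elem g eβ hr
    have Dβ : Dϑ g k (jac g Φ k k) = 0 := Dop_Dop g _ _
    have Dr := Dϑ_inverse eβ hr Dβ
    set β := jac g Φ k k with hβ
    have hr' : r * β = 1 := by rw [← even_mul_comm g eβ, hr]
    set η := Φ (ϑg g k) - ϑg g k * β with hη
    have oη : parity g η = -η := by
      rw [hη, map_sub, map_mul, hΦ.odd, eβ, parity_ϑg, neg_mul]; abel
    have Dη : Dϑ g k η = 0 := by
      have h1 : Dϑ g k (ϑg g k) = 1 := by rw [Dϑ_ϑg, Matrix.one_apply_eq]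
      have h2 : Dϑ g k (Φ (ϑg g k)) = β := rfl
      rw [hη, map_sub, h2]
      unfold Dϑ at h1 Dβ ⊢
      rw [Dop_mul, h1, Dβ, one_mul, mul_zero, add_zero, sub_self]
    obtain ⟨Φ₁, sΦ₁, hΦ₁⟩ := exists_subst g (w := Function.update (ϑg g) k (Φ (ϑg g k)))
      (fun j => by
        by_cases hj : j = k
        · subst hj; simp [hΦ.odd]
        · simp [Function.update_of_ne hj])
    obtain ⟨Ψ, sΨ, hΨ⟩ := exists_subst g (w := Function.update (ϑg g) k (r * (ϑg g k - η)))
      (fun j => by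
        by_cases hj : j = k
        · subst hj
          rw [Function.update_self, map_mul, er, map_sub, oη, parity_ϑg, ← mul_neg]
          congr 1; abel
        · simp [Function.update_of_ne hj])
    have fixΦ₁ : ∀ j, j ≠ k → Φ₁ (ϑg g j) = ϑg g j := fun j hj => by
      rw [hΦ₁, Function.update_of_ne hj]
    have fixΨ : ∀ j, j ≠ k → Ψ (ϑg g j) = ϑg g j := fun j hj => by
      rw [hΨ, Function.update_of_ne hj]
    have hΦ₁k : Φ₁ (ϑg g k) = Φ (ϑg g k) := by rw [hΦ₁, Function.update_self]
    have hΨk : Ψ (ϑg g k) = r * (ϑg g k - η) := by rw [hΨ, Function.update_self]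
    have freeΦ₁ : ∀ x, Dϑ g k x = 0 → Φ₁ x = x := fun x hx => by
      rw [sΦ₁.apply_eq_of_single fixΦ₁, hx, mul_zero, add_zero]
    have freeΨ : ∀ x, Dϑ g k x = 0 → Ψ x = x := fun x hx => by
      rw [sΨ.apply_eq_of_single fixΨ, hx, mul_zero, add_zero]
    have hΨΦk : Ψ (Φ (ϑg g k)) = ϑg g k := by
      have : Φ (ϑg g k) = η + ϑg g k * β := by rw [hη]; abel
      rw [this, map_add, map_mul, freeΨ η Dη, freeΨ β Dβ, hΨk, ← even_mul_comm g eβ,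
        ← mul_assoc, hr, one_mul]
      abel
    have hinv : Φ₁.comp Ψ = AlgHom.id ℂ E := by
      refine subst_ext (sΦ₁.comp sΨ) isSubst_id fun j => ?_
      rw [AlgHom.comp_apply, AlgHom.id_apply]
      by_cases hj : j = k
      · subst hj
        have : Φ (ϑg g j) - η = β * ϑg g j := by rw [hη, even_mul_comm g eβ]; abel
        rw [hΨk, map_mul, map_sub, freeΦ₁ r Dr, freeΦ₁ η Dη, hΦ₁k, this, ← mul_assoc, hr', one_mul]
      · rw [fixΨ j hj, fixΦ₁ j hj]
    have hinv' : Ψ.comp Φ₁ = AlgHom.id ℂ E := by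
      refine subst_ext (sΨ.comp sΦ₁) isSubst_id fun j => ?_
      rw [AlgHom.comp_apply, AlgHom.id_apply]
      by_cases hj : j = k
      · subst hj; rw [hΦ₁k, hΨΦk]
      · rw [fixΦ₁ j hj, fixΨ j hj]
    have hJ₁ : (jac g Φ₁).map (πB g) = Matrix.diagonal (Function.update 1 k (d k)) := by
      ext i j
      rw [Matrix.map_apply, jac, Matrix.of_apply]
      by_cases hj : j = k
      · subst hj
        rw [hΦ₁k]
        refine (hJ' i j).trans ?_
        by_cases hij : i = j
        · subst hij; simp
        · rw [Matrix.diagonal_apply_ne _ hij, Matrix.diagonal_apply_ne _ hij]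
      · rw [fixΦ₁ j hj, Dϑ_ϑg]
        by_cases hij : i = j
        · subst hij; simp [Function.update_of_ne hj]
        · rw [Matrix.diagonal_apply_ne _ hij, Matrix.one_apply_ne hij, map_zero]
    have hbody : ∀ X : Matrix (Fin n) (Fin n) E, (X.map Ψ).map (πB g) = X.map (πB g) := by
      intro X; ext i j; exact sΨ.πB_apply _
    have hd₁ : ∀ j, Function.update (1 : Fin n → ℂ) k (d k) j ≠ 0 := fun j => by
      by_cases hj : j = k
      · subst hj; simpa using hd j
      · simp [Function.update_of_ne hj]
    have hJΨ : (jac g Ψ).map (πB g)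
        = Matrix.diagonal (Function.update (1 : Fin n → ℂ) k (d k))⁻¹ := by
      have h₁ : (jac g Ψ).map (πB g) * Matrix.diagonal (Function.update 1 k (d k)) = 1 := by
        rw [← hJ₁, ← hbody (jac g Φ₁), ← Matrix.map_mul, ← sΨ.jac_comp, hinv', jac_id,
          Matrix.map_one _ (map_zero _) (map_one _)]
      have h₂ : Matrix.diagonal (Function.update (1 : Fin n → ℂ) k (d k)) *
          Matrix.diagonal (Function.update (1 : Fin n → ℂ) k (d k))⁻¹ = 1 := by
        rw [Matrix.diagonal_mul_diagonal, ← Matrix.diagonal_one]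
        congr 1
        ext j
        exact mul_inv_cancel₀ (hd₁ j)
      calc _ = (jac g Ψ).map (πB g) * (Matrix.diagonal (Function.update (1 : Fin n → ℂ) k (d k)) *
          Matrix.diagonal (Function.update (1 : Fin n → ℂ) k (d k))⁻¹) := by rw [h₂, mul_one]
        _ = _ := by rw [← mul_assoc, h₁, one_mul]
    have hΦ' : BerezinCov g (Ψ.comp Φ) := by
      refine ih (sΨ.comp hΦ) (fun j hj => ?_)
        ((Function.update (1 : Fin n → ℂ) k (d k))⁻¹ * d) (fun j => ?_) ?_
      · rw [AlgHom.comp_apply]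
        by_cases hjk : j = k
        · subst hjk; exact hΨΦk
        · rw [hfix j (by simp [hjk, hj]), fixΨ j hjk]
      · exact mul_ne_zero (inv_ne_zero (hd₁ j)) (hd j)
      · rw [sΨ.jac_comp, Matrix.map_mul, hbody, hJ, hJΨ, Matrix.diagonal_mul_diagonal]
        rfl
    have : Φ = Φ₁.comp (Ψ.comp Φ) := by rw [← AlgHom.comp_assoc, hinv, AlgHom.id_comp]
    rw [this]
    refine (sΦ₁.berezinCov_of_single (k := k) fixΦ₁ ?_).comp hΦ'
    have := congrFun (congrFun hJ₁ k) k
    rw [Matrix.map_apply, Matrix.diagonal_apply_eq] at this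
    rw [this]
    exact hd₁ k

lemma parity_linear (M : Matrix (Fin n) (Fin n) ℂ) (k : Fin n) :
    parity g (∑ l, M l k • ϑg g l) = -∑ l, M l k • ϑg g l := by
  simp

lemma jac_linear {M : Matrix (Fin n) (Fin n) ℂ} {Φ : E →ₐ[ℂ] E}
    (h : ∀ k, Φ (ϑg g k) = ∑ l, M l k • ϑg g l) (l k : Fin n) :
    jac g Φ l k = algebraMap ℂ E (M l k) := by
  rw [jac, Matrix.of_apply, h, map_sum]
  simp [Dϑ_ϑg, Matrix.one_apply, Algebra.algebraMap_eq_smul_one]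

lemma berezinCov_linear {M : Matrix (Fin n) (Fin n) ℂ} (hM : M.det ≠ 0) :
    ∀ {Φ : E →ₐ[ℂ] E}, IsSubst g Φ → (∀ k, Φ (ϑg g k) = ∑ l, M l k • ϑg g l) →
      BerezinCov g Φ := by
  refine Matrix.diagonal_transvection_induction_of_det_ne_zero
    (fun M => ∀ {Φ : E →ₐ[ℂ] E}, IsSubst g Φ → (∀ k, Φ (ϑg g k) = ∑ l, M l k • ϑg g l) →
      BerezinCov g Φ) M hM ?_ ?_ ?_
  · intro D hD Φ hΦ h
    refine hΦ.berezinCov_of_diagonal Finset.univ (by simp) D ?_ ?_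
    · rw [Matrix.det_diagonal, Finset.prod_ne_zero_iff] at hD
      exact fun k => hD k (Finset.mem_univ k)
    · ext l k
      rw [Matrix.map_apply, jac_linear h, AlgHom.commutes]; rfl
  · intro t Φ hΦ h
    refine hΦ.berezinCov_of_single (k := t.j) (fun k hk => ?_) ?_
    · rw [h]
      simp [Matrix.TransvectionStruct.toMatrix, Matrix.transvection, Matrix.one_apply,
        hk.symm]
    · rw [jac_linear h, AlgHom.commutes]
      simp [Matrix.TransvectionStruct.toMatrix, Matrix.transvection, t.hij]
  · intro A B hA hB ihA ihB Φ hΦ h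
    obtain ⟨ΦA, sA, hΦA⟩ := exists_subst g (parity_linear (g := g) A)
    obtain ⟨ΦB, sB, hΦB⟩ := exists_subst g (parity_linear (g := g) B)
    have : Φ = ΦA.comp ΦB := by
      refine subst_ext hΦ (sA.comp sB) fun k => ?_
      simp only [AlgHom.comp_apply, h, hΦB, map_sum, map_smul, hΦA, Finset.smul_sum,
        Matrix.mul_apply, Finset.sum_smul, smul_smul]
      rw [Finset.sum_comm]
      simp only [mul_comm]
    rw [this]
    exact (ihA sA hΦA).comp (ihB sB hΦB)

/-- The change of variables formula for the Berezin integral. -/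
theorem IsSubst.berezinCov {Φ : E →ₐ[ℂ] E} (hΦ : IsSubst g Φ)
    {T : Matrix (Fin n) (Fin n) E} (hT : jac g Φ * T = 1) : BerezinCov g Φ := by
  set M := (jac g Φ).map (πB g) with hM
  have hMT : M * T.map (πB g) = 1 := by
    rw [hM, ← Matrix.map_mul, hT, Matrix.map_one _ (map_zero _) (map_one _)]
  have hdet : IsUnit M.det := by
    rw [← Matrix.isUnit_iff_isUnit_det]
    exact IsUnit.of_mul_eq_one _ hMT
  obtain ⟨Φ₁, s₁, hΦ₁⟩ := exists_subst g (parity_linear (g := g) M)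
  obtain ⟨Ψ, sΨ, hΨ⟩ := exists_subst g (parity_linear (g := g) M⁻¹)
  have hinv : Φ₁.comp Ψ = AlgHom.id ℂ E := by
    refine subst_ext (s₁.comp sΨ) isSubst_id fun k => ?_
    have : ∑ r, (M * M⁻¹) r k • ϑg g r = ϑg g k := by
      rw [Matrix.mul_nonsing_inv _ hdet]
      simp [Matrix.one_apply]
    refine Eq.trans ?_ this
    simp only [AlgHom.comp_apply, hΨ, map_sum, map_smul, hΦ₁, Finset.smul_sum,
      Matrix.mul_apply, Finset.sum_smul, smul_smul]
    rw [Finset.sum_comm]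
    simp only [mul_comm]
  have : Φ = Φ₁.comp (Ψ.comp Φ) := by rw [← AlgHom.comp_assoc, hinv, AlgHom.id_comp]
  rw [this]
  refine (berezinCov_linear hdet.ne_zero s₁ hΦ₁).comp
    ((sΨ.comp hΦ).berezinCov_of_diagonal Finset.univ (by simp) 1 (by simp) ?_)
  have hbody : ((jac g Φ).map Ψ).map (πB g) = M := by
    ext i j; exact sΨ.πB_apply _
  have hJ : (jac g Ψ).map (πB g) = M⁻¹ := by
    ext l k
    rw [Matrix.map_apply, jac_linear hΨ, AlgHom.commutes]; rfl
  rw [sΨ.jac_comp, Matrix.map_mul, hbody, hJ, Matrix.nonsing_inv_mul _ hdet]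
  exact Matrix.diagonal_one.symm

end Berezin

section Coefficients

lemma notϑ_fixed_of_mem_ΛSub {x : E} (hx : x ∈ ΛSub g) :
    (∀ k, Dϑ g k x = 0) ∧ ∀ Φ : E →ₐ[ℂ] E, IsSubst g Φ → Φ x = x := by
  have hσ : ∀ i, σg g i = basisGen g (.inl i) := fun _ => rfl
  induction hx using Algebra.adjoin_induction with
  | mem x hx =>
    obtain ⟨i, rfl⟩ := hx
    exact ⟨fun k => Dϑ_basisGen_of_notϑ (i := .inl i) rfl k, fun Φ hΦ => hΦ.fix (.inl i) rfl⟩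
  | algebraMap c =>
    exact ⟨fun k => by simp [Algebra.algebraMap_eq_smul_one, Dϑ], fun Φ _ => Φ.commutes c⟩
  | add x y _ _ hx hy =>
    exact ⟨fun k => by rw [map_add, hx.1, hy.1, add_zero],
      fun Φ hΦ => by rw [map_add, hx.2 Φ hΦ, hy.2 Φ hΦ]⟩
  | mul x y _ _ hx hy =>
    refine ⟨fun k => ?_, fun Φ hΦ => by rw [map_mul, hx.2 Φ hΦ, hy.2 Φ hΦ]⟩
    have h₁ := hx.1 k
    have h₂ := hy.1 k
    unfold Dϑ at h₁ h₂ ⊢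
    rw [Dop_mul, h₁, h₂, zero_mul, mul_zero, add_zero]

lemma Dϑ_mul_of_mem_ΛSub (k : Fin n) (x : E) {c : E} (hc : c ∈ ΛSub g) :
    Dϑ g k (x * c) = Dϑ g k x * c := by
  have h := (notϑ_fixed_of_mem_ΛSub g hc).1 k
  unfold Dϑ at h ⊢
  rw [Dop_mul, h, mul_zero, add_zero]

lemma prod_ofFn_smul {N : ℕ} (c : Fin N → ℂ) (x : Fin N → E) :
    (List.ofFn fun k => c k • x k).prod = (∏ k, c k) • (List.ofFn x).prod := by
  induction N with
  | zero => simp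
  | succ N ih =>
    rw [List.ofFn_succ, List.prod_cons, ih, List.ofFn_succ, List.prod_cons, Fin.prod_univ_succ,
      smul_mul_smul_comm]

lemma parity_ϑpow (a : Fin n → Bool) :
    parity g (ϑpow g a) = (-1 : ℂ) ^ mIdxCard a • ϑpow g a := by
  have h : ∏ k, (if a k then (-1 : ℂ) else 1) = (-1 : ℂ) ^ mIdxCard a := by
    rw [Finset.prod_ite, Finset.prod_const, Finset.prod_const_one, mul_one, mIdxCard]
  rw [ϑpow, ← h, ← prod_ofFn_smul, map_list_prod, List.map_ofFn]
  congr 2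
  funext k
  simp only [Function.comp_apply]
  split_ifs <;> simp

lemma IsSubst.oddprod_eq (Φ : E →ₐ[ℂ] E) (a : Fin n → Bool) :
    oddprod (fun k => Φ (ϑg g k)) a = Φ (ϑpow g a) := by
  rw [oddprod, ϑpow, map_list_prod, List.map_ofFn]
  congr 2
  funext k
  simp only [Function.comp_apply]
  split_ifs <;> simp

lemma parity_sum_even {c : (Fin n → Bool) → E}
    (hc : ∀ a, c a ∈ (if mIdxCard a % 2 = 0 then evenPart g else oddPart g)) :
    parity g (∑ a, ϑpow g a * c a) = ∑ a, ϑpow g a * c a := by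
  rw [map_sum]
  refine Finset.sum_congr rfl fun a _ => ?_
  rw [map_mul, parity_ϑpow]
  have := hc a
  split_ifs at this with h
  · rw [parity_of_mem_evenPart g this, (Nat.even_iff.2 h).neg_one_pow, one_smul]
  · rw [parity_of_mem_oddPart g this, (Nat.not_even_iff_odd.1 (mt Nat.even_iff.1 h)).neg_one_pow]
    simp

lemma parity_sum_odd {c : (Fin n → Bool) → E}
    (hc : ∀ a, c a ∈ (if mIdxCard a % 2 = 0 then oddPart g else evenPart g)) :
    parity g (∑ a, ϑpow g a * c a) = -∑ a, ϑpow g a * c a := by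
  rw [map_sum, ← Finset.sum_neg_distrib]
  refine Finset.sum_congr rfl fun a _ => ?_
  rw [map_mul, parity_ϑpow]
  have := hc a
  split_ifs at this with h
  · rw [parity_of_mem_oddPart g this, (Nat.even_iff.2 h).neg_one_pow, one_smul, mul_neg]
  · rw [parity_of_mem_evenPart g this, (Nat.not_even_iff_odd.1 (mt Nat.even_iff.1 h)).neg_one_pow]
    simp

end Coefficients

section Calculus

include g in
lemma finiteDimensional : FiniteDimensional ℂ E :=
  have : Module.Finite ℂ (ExteriorAlgebra ℂ (GIdx L n → ℂ)) := Module.Finite.of_basis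
    ((Pi.basisFun ℂ (GIdx L n)).reindex (Fintype.equivFin _)).ExteriorAlgebra
  Module.Finite.equiv g.toLinearEquiv

/-- A complex linear endomorphism of `E` as a continuous real linear map. -/
def toRealCLM (p : E →ₗ[ℂ] E) : E →L[ℝ] E :=
  haveI := finiteDimensional g
  (LinearMap.toContinuousLinearMap p).restrictScalars ℝ

include g in
/-- A linear relation satisfied by the values of a function is satisfied by its derivatives. -/
lemma map_fderiv_eq_zero (p : E →ₗ[ℂ] E) {f : (Fin m → ℝ) → E} (h : ∀ q, p (f q) = 0)
    (q v : Fin m → ℝ) : p (fderiv ℝ f q v) = 0 := by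
  by_cases hf : DifferentiableAt ℝ f q
  · have h₁ := (toRealCLM g p).hasFDerivAt.comp q hf.hasFDerivAt
    have h₂ : (toRealCLM g p) ∘ f = fun _ => 0 := funext h
    rw [h₂] at h₁
    have := h₁.unique (hasFDerivAt_const (0 : E) q)
    exact DFunLike.congr_fun this v
  · rw [fderiv_zero_of_not_differentiableAt hf]
    exact map_zero p

include g in
lemma map_pdIter_eq_zero (p : E →ₗ[ℂ] E) (l : List (Fin m)) {f : (Fin m → ℝ) → E}
    (h : ∀ q, p (f q) = 0) (q : Fin m → ℝ) : p (pdIter l f q) = 0 := by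
  induction l generalizing f with
  | nil => exact h q
  | cons i l ih => exact ih fun q => map_fderiv_eq_zero g p h q _

lemma parity_pd_even {f : (Fin m → ℝ) → E} (h : ∀ q, parity g (f q) = f q) (i : Fin m)
    (q : Fin m → ℝ) : parity g (pd i f q) = pd i f q :=
  sub_eq_zero.1 <| map_fderiv_eq_zero g ((parity g).toLinearMap - LinearMap.id)
    (fun q => by simp [h]) q _

lemma parity_pd_odd {f : (Fin m → ℝ) → E} (h : ∀ q, parity g (f q) = -f q) (i : Fin m)
    (q : Fin m → ℝ) : parity g (pd i f q) = -pd i f q :=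
  eq_neg_of_add_eq_zero_left <| map_fderiv_eq_zero g ((parity g).toLinearMap + LinearMap.id)
    (fun q => by simp [h]) q _

variable {g}

lemma IsSubst.gcont_apply {Φ : E →ₐ[ℂ] E} (hΦ : IsSubst g Φ) {F : (Fin m → ℝ) → E}
    (hF : ∀ q, F q ∈ ΛSub g) (x : Fin m → E) :
    gcont g F (fun j => Φ (x j)) = Φ (gcont g F x) := by
  have hb : bodyVec g (fun j => Φ (x j)) = bodyVec g x := by
    funext j; simp only [bodyVec, hΦ.πB_apply]
  have hs : ∀ j, soul g (Φ (x j)) = Φ (soul g (x j)) := fun j => by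
    rw [soul, soul, map_sub, hΦ.πB_apply, AlgHom.commutes]
  have hd : ∀ l q, Φ (pdIter l F q) = pdIter l F q := fun l q =>
    sub_eq_zero.1 <| map_pdIter_eq_zero g (Φ.toLinearMap - LinearMap.id) l
      (fun q => by simp [(notϑ_fixed_of_mem_ΛSub g (hF q)).2 Φ hΦ]) q
  rw [gcont, gcont, map_sum]
  refine Finset.sum_congr rfl fun α _ => ?_
  rw [map_smul, map_mul, hd, hb, map_list_prod, List.map_ofFn]
  congr 4
  funext j
  rw [hs, Function.comp_apply, map_pow]

lemma IsSubst.seval_apply {Φ : E →ₐ[ℂ] E} (hΦ : IsSubst g Φ)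
    {F : (Fin n → Bool) → (Fin m → ℝ) → E} (hF : ∀ a q, F a q ∈ ΛSub g) (x : Fin m → E)
    (w : Fin n → E) :
    ∑ a, oddprod (fun k => Φ (w k)) a * gcont g (F a) (fun j => Φ (x j)) =
      Φ (∑ a, oddprod w a * gcont g (F a) x) := by
  rw [map_sum]
  refine Finset.sum_congr rfl fun a _ => ?_
  rw [map_mul, hΦ.gcont_apply (hF a), oddprod, oddprod, map_list_prod, List.map_ofFn]
  congr 3
  funext k
  simp only [Function.comp_apply]
  split_ifs <;> simp

/-- The derivative of a substitution with respect to parameters. -/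
lemma hasFDerivAt_subst {Φ : (Fin m → ℝ) → E →ₐ[ℂ] E} (hΦ : ∀ p, IsSubst g (Φ p))
    {q : Fin m → ℝ} (hd : ∀ k, DifferentiableAt ℝ (fun p => Φ p (ϑg g k)) q) (x : E) :
    DifferentiableAt ℝ (fun p => Φ p x) q ∧ ∀ v, fderiv ℝ (fun p => Φ p x) q v =
      ∑ k, fderiv ℝ (fun p => Φ p (ϑg g k)) q v * Φ q (Dϑ g k x) := by
  induction x using gen_induction g with
  | one => simp [Dϑ]
  | add x y hx hy =>
    simp only [map_add]
    refine ⟨hx.1.add hy.1, fun v => ?_⟩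
    rw [fderiv_fun_add hx.1 hy.1, add_apply, hx.2, hy.2,
      ← Finset.sum_add_distrib]
    simp only [mul_add]
  | smul c x hx =>
    simp only [map_smul]
    refine ⟨hx.1.const_smul c, fun v => ?_⟩
    rw [fderiv_fun_const_smul hx.1, smul_apply, hx.2, Finset.smul_sum]
    simp only [mul_smul_comm]
  | mul i x hx =>
    have h : DifferentiableAt ℝ (fun p => Φ p (basisGen g i)) q ∧
        ∀ v, fderiv ℝ (fun p => Φ p (basisGen g i)) q v =
          ∑ k, fderiv ℝ (fun p => Φ p (ϑg g k)) q v * Φ q (Dϑ g k (basisGen g i)) := by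
      by_cases hi : notϑ i = true
      · simp [(hΦ _).fix i hi, Dϑ_basisGen_of_notϑ hi]
      · obtain ⟨k, rfl⟩ : ∃ k, i = .inr (.inr (.inr k)) := by
          rcases i with i | i | i | i <;> simp_all [notϑ]
        refine ⟨hd k, fun v => ?_⟩
        change fderiv ℝ (fun p => Φ p (ϑg g k)) q v = ∑ k', _ * Φ q (Dϑ g k' (ϑg g k))
        simp [Dϑ_ϑg, Matrix.one_apply, apply_ite]
    simp only [map_mul]
    refine ⟨h.1.mul hx.1, fun v => ?_⟩
    have h₂ : ∀ (j : Fin n) (y z : E), Dϑ g j (y * z) = Dϑ g j y * z + parity g y * Dϑ g j z :=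
      fun j y z => Dop_mul g _ y z
    have hodd : ∀ k, parity g (fderiv ℝ (fun p => Φ p (ϑg g k)) q v) =
        -fderiv ℝ (fun p => Φ p (ϑg g k)) q v := fun k =>
      eq_neg_of_add_eq_zero_left <| map_fderiv_eq_zero g ((parity g).toLinearMap + LinearMap.id)
        (fun p => by simp [(hΦ p).odd]) q _
    rw [fderiv_fun_mul' h.1 hx.1]
    simp only [add_apply, smul_apply, hx.2, h.2,
      smul_eq_mul, MulOpposite.smul_eq_mul_unop, MulOpposite.unop_op]
    rw [Finset.sum_mul, Finset.mul_sum, ← Finset.sum_add_distrib]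
    refine Finset.sum_congr rfl fun k _ => ?_
    rw [h₂, SuperCalc.parity_basisGen, map_add, map_mul, map_mul, map_neg, ← mul_assoc (Φ q _),
      odd_mul_odd g ((hΦ q).parity_basisGen i) (hodd k)]
    noncomm_ring

/-- The chain rule for the even derivatives of a superfunction composed with a substitution. -/
lemma pd_comp_subst {Φ : (Fin m → ℝ) → E →ₐ[ℂ] E} (hΦ : ∀ p, IsSubst g (Φ p))
    {q : Fin m → ℝ} (hd : ∀ k, DifferentiableAt ℝ (fun p => Φ p (ϑg g k)) q)
    {φ : (Fin m → ℝ) → Fin m → ℝ} (hφ : DifferentiableAt ℝ φ q)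
    {c : (Fin n → Bool) → (Fin m → ℝ) → E} (hc : ∀ a q, c a q ∈ ΛSub g)
    (hcd : ∀ a, DifferentiableAt ℝ (c a) (φ q)) (i : Fin m) :
    pd i (fun p => ∑ a, Φ p (ϑpow g a) * c a (φ p)) q =
      ∑ r, algebraMap ℂ E (fderiv ℝ φ q (Pi.single i 1) r : ℝ) *
        Φ q (pd r (fun p => ∑ a, ϑpow g a * c a p) (φ q)) +
      ∑ k, pd i (fun p => Φ p (ϑg g k)) q * Φ q (Dϑ g k (∑ a, ϑpow g a * c a (φ q))) := by
  have hs := hasFDerivAt_subst hΦ hd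
  have hcc : ∀ a, DifferentiableAt ℝ (fun p => c a (φ p)) q := fun a => (hcd a).comp q hφ
  have hfix : ∀ a v, Φ q (fderiv ℝ (c a) (φ q) v) = fderiv ℝ (c a) (φ q) v := fun a v =>
    sub_eq_zero.1 <| map_fderiv_eq_zero g ((Φ q).toLinearMap - LinearMap.id)
      (fun p => by simp [(notϑ_fixed_of_mem_ΛSub g (hc a p)).2 _ (hΦ q)]) _ _
  have h₁ : ∀ r, pd r (fun p => ∑ a, ϑpow g a * c a p) (φ q) =
      ∑ a, ϑpow g a * fderiv ℝ (c a) (φ q) (Pi.single r 1) := fun r => by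
    rw [pd, fderiv_fun_sum fun a _ => (hcd a).const_mul _, sum_apply]
    refine Finset.sum_congr rfl fun a _ => ?_
    rw [fderiv_const_mul (hcd a)]
    rfl
  have h₂ : ∀ a, fderiv ℝ (fun p => Φ p (ϑpow g a) * c a (φ p)) q (Pi.single i 1) =
      ∑ r, algebraMap ℂ E (fderiv ℝ φ q (Pi.single i 1) r : ℝ) *
        Φ q (ϑpow g a * fderiv ℝ (c a) (φ q) (Pi.single r 1)) +
      ∑ k, pd i (fun p => Φ p (ϑg g k)) q * Φ q (Dϑ g k (ϑpow g a * c a (φ q))) := fun a => by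
    rw [fderiv_fun_mul' (hs _).1 (hcc a)]
    simp only [add_apply, smul_apply, (hs (ϑpow g a)).2,
      smul_eq_mul, MulOpposite.smul_eq_mul_unop, MulOpposite.unop_op]
    have h₃ : fderiv ℝ (fun p => c a (φ p)) q (Pi.single i 1) =
        ∑ r, algebraMap ℂ E (fderiv ℝ φ q (Pi.single i 1) r : ℝ) *
          fderiv ℝ (c a) (φ q) (Pi.single r 1) := by
      rw [show (fun p => c a (φ p)) = c a ∘ φ from rfl, fderiv_comp q (hcd a) hφ,
        ContinuousLinearMap.comp_apply]
      conv_lhs => rw [pi_eq_sum_univ' (fderiv ℝ φ q (Pi.single i 1)), map_sum]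
      refine Finset.sum_congr rfl fun r _ => ?_
      rw [map_smul, ← Algebra.smul_def]
      rfl
    congr 1
    · rw [h₃, Finset.mul_sum]
      refine Finset.sum_congr rfl fun r _ => ?_
      rw [map_mul, hfix, ← mul_assoc, ← mul_assoc, Algebra.commutes]
    · rw [Finset.sum_mul]
      refine Finset.sum_congr rfl fun k _ => ?_
      rw [Dϑ_mul_of_mem_ΛSub g k _ (hc a _), map_mul,
        (notϑ_fixed_of_mem_ΛSub g (hc a _)).2 _ (hΦ q), mul_assoc]
      rfl
  rw [pd, fderiv_fun_sum fun a _ => (hs (ϑpow g a)).1.fun_mul (hcc a), sum_apply]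
  simp only [h₁, h₂, map_sum, Finset.mul_sum, Finset.sum_add_distrib]
  congr 1 <;> exact Finset.sum_comm

end Calculus

section Reparametrization

omit [NormedAlgebra ℂ E] in
lemma detE_map_ringHom {R : Type*} [CommRing R] {k : ℕ} (ρ : R →+* E)
    (M : Matrix (Fin k) (Fin k) R) : detE (M.map ρ) = ρ M.det := by
  simp only [detE, Matrix.det_apply, map_sum, ← List.prod_ofFn, Units.smul_def, map_zsmul,
    map_list_prod, List.map_ofFn]
  rfl

variable {g}

/-- Transformation of the integrand of the VV-integral under a reparametrization. -/
lemma integrand_comp_subst {Φ : (Fin m → ℝ) → E →ₐ[ℂ] E} (hΦ : ∀ p, IsSubst g (Φ p))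
    {q : Fin m → ℝ} (hd : ∀ k, DifferentiableAt ℝ (fun p => Φ p (ϑg g k)) q)
    {φ : (Fin m → ℝ) → Fin m → ℝ} (hφ : DifferentiableAt ℝ φ q)
    (hdet : (Matrix.of fun i j => fderiv ℝ φ q (Pi.single j 1) i).det ≠ 0)
    {T : Matrix (Fin n) (Fin n) E} (hT : jac g (Φ q) * T = 1)
    {γ0c : Fin m → (Fin n → Bool) → (Fin m → ℝ) → E}
    {γ1c : Fin n → (Fin n → Bool) → (Fin m → ℝ) → E}
    (hγ0d : ∀ j a, DifferentiableAt ℝ (γ0c j a) (φ q))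
    (hγ1d : ∀ k a, DifferentiableAt ℝ (γ1c k a) (φ q))
    (hγ0Λ : ∀ j a q, γ0c j a q ∈ ΛSub g) (hγ1Λ : ∀ k a q, γ1c k a q ∈ ΛSub g)
    (hγ0parity : ∀ j a q,
      γ0c j a q ∈ (if mIdxCard a % 2 = 0 then evenPart g else oddPart g))
    (hγ1parity : ∀ k a q,
      γ1c k a q ∈ (if mIdxCard a % 2 = 0 then oddPart g else evenPart g))
    {P P' : Matrix (Fin m) (Fin m) E} {s s' : E}
    (hP : (Matrix.of fun i j =>
        pd i (fun p => ∑ a : Fin n → Bool, ϑpow g a * γ0c j a p) (φ q)) * P = 1 ∧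
      P * (Matrix.of fun i j =>
        pd i (fun p => ∑ a : Fin n → Bool, ϑpow g a * γ0c j a p) (φ q)) = 1)
    (hs : detE ((Matrix.of fun l k => Dϑ g l (∑ a : Fin n → Bool, ϑpow g a * γ1c k a (φ q)))
        - (Matrix.of fun l j => Dϑ g l (∑ a : Fin n → Bool, ϑpow g a * γ0c j a (φ q)))
          * P * (Matrix.of fun i k =>
              pd i (fun p => ∑ a : Fin n → Bool, ϑpow g a * γ1c k a p) (φ q))) * s = 1)
    (hP' : (Matrix.of fun i j =>
        pd i (fun p => ∑ a : Fin n → Bool, Φ p (ϑpow g a) * γ0c j a (φ p)) q) * P' = 1)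
    (hs' : detE ((Matrix.of fun l k =>
          Dϑ g l (∑ a : Fin n → Bool, Φ q (ϑpow g a) * γ1c k a (φ q)))
        - (Matrix.of fun l j => Dϑ g l (∑ a : Fin n → Bool, Φ q (ϑpow g a) * γ0c j a (φ q)))
          * P' * (Matrix.of fun i k =>
              pd i (fun p => ∑ a : Fin n → Bool, Φ p (ϑpow g a) * γ1c k a (φ p)) q)) * s' = 1)
    {F : (Fin n → Bool) → (Fin m → ℝ) → E} (hF : ∀ a q, F a q ∈ ΛSub g) :
    Bϑ g ((detE (Matrix.of fun i j =>
          pd i (fun p => ∑ a : Fin n → Bool, Φ p (ϑpow g a) * γ0c j a (φ p)) q) * s')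
        * ∑ a : Fin n → Bool,
            oddprod (fun k => ∑ b : Fin n → Bool, Φ q (ϑpow g b) * γ1c k b (φ q)) a
              * gcont g (F a) (fun j => ∑ b : Fin n → Bool, Φ q (ϑpow g b) * γ0c j b (φ q))) =
      (Matrix.of fun i j => fderiv ℝ φ q (Pi.single j 1) i).det •
        Bϑ g ((detE (Matrix.of fun i j =>
            pd i (fun p => ∑ a : Fin n → Bool, ϑpow g a * γ0c j a p) (φ q)) * s)
          * ∑ a : Fin n → Bool,
              oddprod (fun k => ∑ b : Fin n → Bool, ϑpow g b * γ1c k b (φ q)) a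
                * gcont g (F a) (fun j => ∑ b : Fin n → Bool, ϑpow g b * γ0c j b (φ q))) := by
  set J := Matrix.of fun i j => fderiv ℝ φ q (Pi.single j 1) i with hJ
  let ρ : ℝ →+* E := (algebraMap ℂ E).comp Complex.ofRealHom
  obtain ⟨r, hr, hB⟩ := ((hΦ q).berezinCov hT).2
  have hsum : ∀ c : (Fin n → Bool) → (Fin m → ℝ) → E, (∀ a q, c a q ∈ ΛSub g) →
      ∑ a, Φ q (ϑpow g a) * c a (φ q) = Φ q (∑ a, ϑpow g a * c a (φ q)) := fun c hc => by
    rw [map_sum]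
    refine Finset.sum_congr rfl fun a _ => ?_
    rw [map_mul, (notϑ_fixed_of_mem_ΛSub g (hc a _)).2 _ (hΦ q)]
  have hy0 : ∀ j q, parity g (∑ a, ϑpow g a * γ0c j a q) = ∑ a, ϑpow g a * γ0c j a q :=
    fun j q => parity_sum_even g fun a => hγ0parity j a q
  have hy1 : ∀ k q, parity g (∑ a, ϑpow g a * γ1c k a q) = -∑ a, ϑpow g a * γ1c k a q :=
    fun k q => parity_sum_odd g fun a => hγ1parity k a q
  set A : Matrix (Fin m) (Fin m) E := Matrix.of fun i j =>
    pd i (fun p => ∑ a : Fin n → Bool, ϑpow g a * γ0c j a p) (φ q) with hA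
  set B : Matrix (Fin n) (Fin n) E := Matrix.of fun l k =>
    Dϑ g l (∑ a : Fin n → Bool, ϑpow g a * γ1c k a (φ q)) with hB'
  set C : Matrix (Fin m) (Fin n) E := Matrix.of fun i k =>
    pd i (fun p => ∑ a : Fin n → Bool, ϑpow g a * γ1c k a p) (φ q) with hC
  set D : Matrix (Fin n) (Fin m) E := Matrix.of fun l j =>
    Dϑ g l (∑ a : Fin n → Bool, ϑpow g a * γ0c j a (φ q)) with hD
  let c : Matrix (Fin m) (Fin n) E := Matrix.of fun i k => pd i (fun p => Φ p (ϑg g k)) q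
  have eA : (Matrix.of fun i j => pd i (fun p => ∑ a : Fin n → Bool,
      Φ p (ϑpow g a) * γ0c j a (φ p)) q) = J.transpose.map ρ * A.map (Φ q) + c * D.map (Φ q) := by
    ext i j
    exact pd_comp_subst hΦ hd hφ (hγ0Λ j) (hγ0d j) i
  have eC : (Matrix.of fun i k => pd i (fun p => ∑ a : Fin n → Bool,
      Φ p (ϑpow g a) * γ1c k a (φ p)) q) = J.transpose.map ρ * C.map (Φ q) + c * B.map (Φ q) := by
    ext i k
    exact pd_comp_subst hΦ hd hφ (hγ1Λ k) (hγ1d k) i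
  have eD : (Matrix.of fun l j => Dϑ g l (∑ a : Fin n → Bool, Φ q (ϑpow g a) * γ0c j a (φ q))) =
      jac g (Φ q) * D.map (Φ q) := by
    ext l j
    rw [Matrix.of_apply, hsum _ (hγ0Λ j), (hΦ q).Dϑ_apply]
    rfl
  have eB : (Matrix.of fun l k => Dϑ g l (∑ a : Fin n → Bool, Φ q (ϑpow g a) * γ1c k a (φ q))) =
      jac g (Φ q) * B.map (Φ q) := by
    ext l k
    rw [Matrix.of_apply, hsum _ (hγ1Λ k), (hΦ q).Dϑ_apply]
    rfl
  have hdetJ : detE (J.transpose.map ρ) = algebraMap ℂ E (J.det : ℝ) := by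
    rw [detE_map_ringHom, Matrix.det_transpose]
    rfl
  have hρ : ∀ i j, parity g (J.transpose.map ρ i j) = J.transpose.map ρ i j :=
    fun i j => (parity g).commutes _
  obtain ⟨a', haa', ha'a⟩ := exists_inverse g hρ (s := algebraMap ℂ E ((J.det : ℝ) : ℂ)⁻¹) (by
    rw [hdetJ, ← map_mul, mul_inv_cancel₀ (Complex.ofReal_ne_zero.2 hdet), map_one])
  have hone : (1 : Matrix (Fin m) (Fin m) E).map (Φ q) = 1 :=
    Matrix.map_one _ (map_zero _) (map_one _)
  rw [eA] at hP'
  rw [eB, eC, eD] at hs'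
  have key := sdet_mul g (a := J.transpose.map ρ) (A := A.map (Φ q)) (P := P.map (Φ q)) (P' := P')
    (b := jac g (Φ q)) (B := B.map (Φ q)) (c := c) (C := C.map (Φ q)) (D := D.map (Φ q))
    (a' := a') (s := Φ q s) (s' := s') (sb := r) hρ
    (fun i j => by
      rw [Matrix.map_apply, (hΦ q).parity_apply, hA, Matrix.of_apply, parity_pd_even g (hy0 j)])
    (hΦ q).parity_jac
    (fun l k => by
      rw [Matrix.map_apply, (hΦ q).parity_apply, hB', Matrix.of_apply, Dϑ, parity_Dop, hy1,
        map_neg, map_neg, map_neg, neg_neg])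
    (fun i k => parity_pd_odd g (fun p => (hΦ p).odd k) i q)
    (fun i k => by
      rw [Matrix.map_apply, (hΦ q).parity_apply, hC, Matrix.of_apply, parity_pd_odd g (hy1 k),
        map_neg])
    (fun l j => by
      rw [Matrix.map_apply, (hΦ q).parity_apply, hD, Matrix.of_apply, Dϑ, parity_Dop, hy0,
        map_neg])
    haa' ha'a (by rw [← Matrix.map_mul, hP.1, hone]) (by rw [← Matrix.map_mul, hP.2, hone])
    (by
      have hsub : (B - D * P * C).map (Φ q) =
          B.map (Φ q) - D.map (Φ q) * P.map (Φ q) * C.map (Φ q) := by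
        rw [Matrix.map_sub _ (map_sub _), Matrix.map_mul, Matrix.map_mul]
      rw [← hsub, ← map_detE, ← map_mul, hs, map_one])
    hr hP' hs'
  have hu : ∑ a : Fin n → Bool,
      oddprod (fun k => ∑ b : Fin n → Bool, Φ q (ϑpow g b) * γ1c k b (φ q)) a
        * gcont g (F a) (fun j => ∑ b : Fin n → Bool, Φ q (ϑpow g b) * γ0c j b (φ q)) =
      Φ q (∑ a : Fin n → Bool,
        oddprod (fun k => ∑ b : Fin n → Bool, ϑpow g b * γ1c k b (φ q)) a
          * gcont g (F a) (fun j => ∑ b : Fin n → Bool, ϑpow g b * γ0c j b (φ q))) := by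
    simp only [hsum _ (hγ0Λ _), hsum _ (hγ1Λ _)]
    exact (hΦ q).seval_apply hF _ _
  rw [eA, key, hu, hdetJ, ← map_detE, ← map_mul, mul_assoc, mul_assoc, ← map_mul,
    ← Algebra.smul_def, Bϑ_smul, hB]
  rfl

end Reparametrization

end SuperCalc

/-- **Reparametrization invariance of the VV-integral over foliated singular manifolds.**
Let `Ω, Ω' ⊆ ℝ^m` be domains, `φ₀ : Ω' → Ω` a `C^∞` diffeomorphism with positive Jacobian
determinant, and `φ₁(q',ϑ')` a tuple of odd supersmooth expressions (valued in the subalgebra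
generated by the `σ`'s and `ϑ`'s) with `∂φ₁/∂ϑ'` invertible at every point; set
`φ = (φ₀,φ₁)`.  Then for every path `γ` from `Ω̃ = Ω × (ϑ₁,…,ϑₙ)` (given by coefficient
families `γ0c`, `γ1c`) with `sdet J(γ)` invertible, and every supersmooth `u` (coefficients
`F`) integrable on `𝔐 = γ(Ω̃)`, the composite `γ∘φ` is a path from `Ω̃'` and
`VV∬_{γ(Ω̃)} dxdθ u = VV∬_{(γ∘φ)(Ω̃')} dx'dθ' u`.  Here the VV-integral along a path `δ`
is `∫ dq [coefficient of ϑ₁⋯ϑₙ in sdet J(δ)(q,ϑ)·u(δ(q,ϑ))]`, and all superdeterminants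
`sdet [[A,C],[D,B]] = det A·(det(B − D A⁻¹ C))⁻¹` are expressed through the given (unique,
two-sided) inverses. -/
theorem vv_integral_reparametrization
    (g : ExteriorAlgebra ℂ (GIdx L n → ℂ) ≃ₐ[ℂ] E)
    (Ω Ω' : Set (Fin m → ℝ)) (hΩ : IsOpen Ω ∧ IsConnected Ω)
    (hΩ' : IsOpen Ω' ∧ IsConnected Ω')
    -- the reparametrization φ = (φ₀, φ₁)
    (φ0 : (Fin m → ℝ) → (Fin m → ℝ)) (hφ0smooth : ContDiffOn ℝ (⊤ : ℕ∞) φ0 Ω')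
    (hφ0maps : ∀ q' ∈ Ω', φ0 q' ∈ Ω)
    (φ0inv : (Fin m → ℝ) → (Fin m → ℝ)) (hφ0invsmooth : ContDiffOn ℝ (⊤ : ℕ∞) φ0inv Ω)
    (hφ0invmaps : ∀ q ∈ Ω, φ0inv q ∈ Ω')
    (hφ0left : ∀ q' ∈ Ω', φ0inv (φ0 q') = q') (hφ0right : ∀ q ∈ Ω, φ0 (φ0inv q) = q)
    (hφ0det : ∀ q' ∈ Ω',
      0 < (Matrix.of fun i j => fderiv ℝ φ0 q' (Pi.single j 1) i).det)
    (φ1 : Fin n → (Fin m → ℝ) → E)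
    (hφ1smooth : ∀ k, ContDiffOn ℝ (⊤ : ℕ∞) (φ1 k) Ω')
    (hφ1mem : ∀ k q', φ1 k q' ∈ ΛϑSub g ∧ φ1 k q' ∈ oddPart g)
    (Tinv : (Fin m → ℝ) → Matrix (Fin n) (Fin n) E)
    (hTinv : ∀ q' ∈ Ω',
      (Matrix.of fun l k => Dϑ g l (φ1 k q')) * Tinv q' = 1 ∧
      Tinv q' * (Matrix.of fun l k => Dϑ g l (φ1 k q')) = 1)
    -- the path γ, by ϑ-coefficient families
    (γ0c : Fin m → (Fin n → Bool) → (Fin m → ℝ) → E)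
    (γ1c : Fin n → (Fin n → Bool) → (Fin m → ℝ) → E)
    (hγ0smooth : ∀ j a, ContDiffOn ℝ (⊤ : ℕ∞) (γ0c j a) Ω)
    (hγ1smooth : ∀ k a, ContDiffOn ℝ (⊤ : ℕ∞) (γ1c k a) Ω)
    (hγ0Λ : ∀ j a q, γ0c j a q ∈ ΛSub g) (hγ1Λ : ∀ k a q, γ1c k a q ∈ ΛSub g)
    (hγ0parity : ∀ j a q,
      γ0c j a q ∈ (if mIdxCard a % 2 = 0 then evenPart g else oddPart g))
    (hγ1parity : ∀ k a q,
      γ1c k a q ∈ (if mIdxCard a % 2 = 0 then oddPart g else evenPart g))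
    (hγ0bodyreal : ∀ j q, q ∈ Ω → (πB g (γ0c j (fun _ => false) q)).im = 0)
    -- invertibility data for sdet J(γ) along Ω̃
    (Pγ : (Fin m → ℝ) → Matrix (Fin m) (Fin m) E)
    (hPγ : ∀ q ∈ Ω,
      (Matrix.of fun i j =>
        pd i (fun p => ∑ a : Fin n → Bool, ϑpow g a * γ0c j a p) q) * Pγ q = 1 ∧
      Pγ q * (Matrix.of fun i j =>
        pd i (fun p => ∑ a : Fin n → Bool, ϑpow g a * γ0c j a p) q) = 1)
    (sγ : (Fin m → ℝ) → E)
    (hsγ : ∀ q ∈ Ω,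
      detE ((Matrix.of fun l k => Dϑ g l (∑ a : Fin n → Bool, ϑpow g a * γ1c k a q))
        - (Matrix.of fun l j => Dϑ g l (∑ a : Fin n → Bool, ϑpow g a * γ0c j a q))
          * Pγ q * (Matrix.of fun i k =>
              pd i (fun p => ∑ a : Fin n → Bool, ϑpow g a * γ1c k a p) q)) * sγ q = 1 ∧
      sγ q * detE ((Matrix.of fun l k =>
            Dϑ g l (∑ a : Fin n → Bool, ϑpow g a * γ1c k a q))
        - (Matrix.of fun l j => Dϑ g l (∑ a : Fin n → Bool, ϑpow g a * γ0c j a q))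
          * Pγ q * (Matrix.of fun i k =>
              pd i (fun p => ∑ a : Fin n → Bool, ϑpow g a * γ1c k a p) q)) = 1)
    -- invertibility data for sdet J(γ∘φ) along Ω̃'
    (Pc : (Fin m → ℝ) → Matrix (Fin m) (Fin m) E)
    (hPc : ∀ q' ∈ Ω',
      (Matrix.of fun i j =>
        pd i (fun p => ∑ a : Fin n → Bool,
          oddprod (fun k => φ1 k p) a * γ0c j a (φ0 p)) q') * Pc q' = 1 ∧
      Pc q' * (Matrix.of fun i j =>
        pd i (fun p => ∑ a : Fin n → Bool,
          oddprod (fun k => φ1 k p) a * γ0c j a (φ0 p)) q') = 1)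
    (sc : (Fin m → ℝ) → E)
    (hsc : ∀ q' ∈ Ω',
      detE ((Matrix.of fun l k => Dϑ g l (∑ a : Fin n → Bool,
            oddprod (fun k' => φ1 k' q') a * γ1c k a (φ0 q')))
        - (Matrix.of fun l j => Dϑ g l (∑ a : Fin n → Bool,
            oddprod (fun k' => φ1 k' q') a * γ0c j a (φ0 q')))
          * Pc q' * (Matrix.of fun i k =>
              pd i (fun p => ∑ a : Fin n → Bool,
                oddprod (fun k' => φ1 k' p) a * γ1c k a (φ0 p)) q')) * sc q' = 1 ∧
      sc q' * detE ((Matrix.of fun l k => Dϑ g l (∑ a : Fin n → Bool,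
            oddprod (fun k' => φ1 k' q') a * γ1c k a (φ0 q')))
        - (Matrix.of fun l j => Dϑ g l (∑ a : Fin n → Bool,
            oddprod (fun k' => φ1 k' q') a * γ0c j a (φ0 q')))
          * Pc q' * (Matrix.of fun i k =>
              pd i (fun p => ∑ a : Fin n → Bool,
                oddprod (fun k' => φ1 k' p) a * γ1c k a (φ0 p)) q')) = 1)
    -- the supersmooth integrand u (defined over an open set O containing the bodies
    -- of the foliated singular manifold 𝔐 = γ(Ω̃)), integrable on 𝔐
    (O : Set (Fin m → ℝ)) (hOopen : IsOpen O)
    (hγbody : ∀ q ∈ Ω, (fun j => (πB g (γ0c j (fun _ => false) q)).re) ∈ O)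
    (F : (Fin n → Bool) → (Fin m → ℝ) → E)
    (hFsmooth : ∀ a, ContDiffOn ℝ (⊤ : ℕ∞) (F a) O)
    (hFΛ : ∀ a q, F a q ∈ ΛSub g)
    (hFint : IntegrableOn (fun q =>
      Bϑ g ((detE (Matrix.of fun i j =>
            pd i (fun p => ∑ a : Fin n → Bool, ϑpow g a * γ0c j a p) q) * sγ q)
        * ∑ a : Fin n → Bool,
            oddprod (fun k => ∑ b : Fin n → Bool, ϑpow g b * γ1c k b q) a
              * gcont g (F a) (fun j => ∑ b : Fin n → Bool, ϑpow g b * γ0c j b q)))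
      Ω volume) :
    (∫ q in Ω,
      Bϑ g ((detE (Matrix.of fun i j =>
            pd i (fun p => ∑ a : Fin n → Bool, ϑpow g a * γ0c j a p) q) * sγ q)
        * ∑ a : Fin n → Bool,
            oddprod (fun k => ∑ b : Fin n → Bool, ϑpow g b * γ1c k b q) a
              * gcont g (F a) (fun j => ∑ b : Fin n → Bool, ϑpow g b * γ0c j b q)))
      = ∫ q' in Ω',
          Bϑ g ((detE (Matrix.of fun i j =>
                pd i (fun p => ∑ a : Fin n → Bool,
                  oddprod (fun k => φ1 k p) a * γ0c j a (φ0 p)) q') * sc q')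
            * ∑ a : Fin n → Bool,
                oddprod (fun k => ∑ b : Fin n → Bool,
                  oddprod (fun k' => φ1 k' q') b * γ1c k b (φ0 q')) a
                  * gcont g (F a)
                      (fun j => ∑ b : Fin n → Bool,
                        oddprod (fun k' => φ1 k' q') b * γ0c j b (φ0 q'))) := by
  have hw : ∀ p k, SuperCalc.parity g (φ1 k p) = -φ1 k p := fun p k =>
    SuperCalc.parity_of_mem_oddPart g (hφ1mem k p).2
  choose Φ hΦ hΦϑ using fun p => SuperCalc.exists_subst g (hw p)
  obtain rfl : φ1 = fun k p => Φ p (ϑg g k) := by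
    funext k p
    exact (hΦϑ p k).symm
  have htop : ((⊤ : ℕ∞) : WithTop ℕ∞) ≠ 0 := by simp
  have hφd : ∀ q ∈ Ω', DifferentiableAt ℝ φ0 q := fun q hq =>
    (hφ0smooth.contDiffAt (hΩ'.1.mem_nhds hq)).differentiableAt htop
  have himage : φ0 '' Ω' = Ω :=
    Set.Subset.antisymm (Set.image_subset_iff.2 hφ0maps)
      fun q hq => ⟨φ0inv q, hφ0invmaps q hq, hφ0right q hq⟩
  simp only [SuperCalc.IsSubst.oddprod_eq] at hPc hsc ⊢
  rw [← himage, integral_image_eq_integral_abs_det_fderiv_smul volume hΩ'.1.measurableSet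
    (fun q hq => (hφd q hq).hasFDerivAt.hasFDerivWithinAt)
    (Set.LeftInvOn.injOn (f₁' := φ0inv) hφ0left)]
  refine setIntegral_congr_fun hΩ'.1.measurableSet fun q hq => ?_
  have hdet : (fderiv ℝ φ0 q).det =
      (Matrix.of fun i j => fderiv ℝ φ0 q (Pi.single j 1) i).det := by
    rw [ContinuousLinearMap.det, ← LinearMap.det_toMatrix']
    congr 1
  have hq' := hφ0maps q hq
  rw [hdet, abs_of_pos (hφ0det q hq)]
  exact (SuperCalc.integrand_comp_subst hΦ
    (fun k => ((hφ1smooth k).contDiffAt (hΩ'.1.mem_nhds hq)).differentiableAt htop) (hφd q hq)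
    (hφ0det q hq).ne' (hTinv q hq).1
    (fun j a => ((hγ0smooth j a).contDiffAt (hΩ.1.mem_nhds hq')).differentiableAt htop)
    (fun k a => ((hγ1smooth k a).contDiffAt (hΩ.1.mem_nhds hq')).differentiableAt htop)
    hγ0Λ hγ1Λ hγ0parity hγ1parity (hPγ _ hq') (hsγ _ hq').1 (hPc q hq).1 (hsc q hq).1 hFΛ).symm
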